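/- For every finite simple graph G, the following are equivalent: (1) G has directed spaghetti treewidth at most two; (2) every block of G is a mamba; (3) G has no minor isomorphic to K_4, D_3, or S_3. -/

import Mathlib

open SimpleGraph

/-- The cycle graph on `ZMod n` (for `3 ≤ n` this is a cycle of length `n`). -/
def cycGraph (n : ℕ) : SimpleGraph (ZMod n) :=
  SimpleGraph.fromRel (fun x y => x = y + 1)

/-- The set `s` of nodes induces a path in the graph `H`. -/
def IsPathSet {ι : Type} (H : SimpleGraph ι) (s : Set ι) : Prop :=
  (H.induce s).Connected ∧ ∀ x ∈ s, {y | y ∈ s ∧ H.Adj x y}.ncard ≤ 2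

/-- The set `s` of nodes induces a directed path in `H` with respect to the
orientation `o` of the edges of `H`. -/
def IsDirPathSet {ι : Type} (H : SimpleGraph ι) (o : ι → ι → Prop) (s : Set ι) : Prop :=
  IsPathSet H s ∧ (∀ x ∈ s, {y | y ∈ s ∧ o x y}.ncard ≤ 1) ∧
    (∀ x ∈ s, {y | y ∈ s ∧ o y x}.ncard ≤ 1)

/-- A tree decomposition of a finite simple graph `G`. -/
structure TreeDecomp {V : Type} (G : SimpleGraph V) where
  ι : Type
  finι : Finite ι
  tree : SimpleGraph ι
  isTree : tree.IsTree
  bag : ι → Set V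
  bag_cover : ∀ v : V, ∃ x, v ∈ bag x
  bag_edge : ∀ ⦃u v : V⦄, G.Adj u v → ∃ x, u ∈ bag x ∧ v ∈ bag x
  bag_conn : ∀ v : V, (tree.induce {x | v ∈ bag x}).Connected

/-- A spaghetti tree decomposition: for every vertex `v` of `G`, the nodes whose
bags contain `v` induce a path in the tree. -/
structure SpaghettiTD {V : Type} (G : SimpleGraph V) extends TreeDecomp G where
  bag_path : ∀ v : V, IsPathSet tree {x | v ∈ bag x}

/-- A directed spaghetti tree decomposition: the tree edges are oriented, and for
every vertex `v` of `G` the nodes whose bags contain `v` induce a directed path. -/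
structure DirSpaghettiTD {V : Type} (G : SimpleGraph V) extends TreeDecomp G where
  orient : ι → ι → Prop
  orient_iff : ∀ x y : ι, tree.Adj x y ↔ (orient x y ∨ orient y x)
  orient_asymm : ∀ x y : ι, orient x y → ¬ orient y x
  bag_dirpath : ∀ v : V, IsDirPathSet tree orient {x | v ∈ bag x}

/-- A special tree decomposition: the tree is rooted, and for every vertex `v` of
`G` the nodes whose bags contain `v` induce a vertical path, i.e. a directed path
with respect to the orientation of every tree edge towards the root. -/
structure SpecialTD {V : Type} (G : SimpleGraph V) extends TreeDecomp G where
  root : ι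
  bag_vertical : ∀ v : V,
    IsDirPathSet tree (fun x y => tree.Adj x y ∧ tree.dist y root < tree.dist x root)
      {x | v ∈ bag x}

/-- A path decomposition of a finite simple graph `G`. -/
structure PathDecomp {V : Type} (G : SimpleGraph V) where
  m : ℕ
  hm : 0 < m
  bag : Fin m → Set V
  bag_cover : ∀ v : V, ∃ i, v ∈ bag i
  bag_edge : ∀ ⦃u v : V⦄, G.Adj u v → ∃ i, u ∈ bag i ∧ v ∈ bag i
  bag_convex : ∀ (v : V) (i j k : Fin m), i ≤ j → j ≤ k → v ∈ bag i → v ∈ bag k → v ∈ bag j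

/-- Treewidth: minimal width of a tree decomposition. -/
noncomputable def treewidth {V : Type} (G : SimpleGraph V) : ℕ :=
  sInf {k | ∃ td : TreeDecomp G, ∀ x, (td.bag x).ncard ≤ k + 1}

/-- Spaghetti treewidth: minimal width of a spaghetti tree decomposition. -/
noncomputable def sptw {V : Type} (G : SimpleGraph V) : ℕ :=
  sInf {k | ∃ td : SpaghettiTD G, ∀ x, (td.bag x).ncard ≤ k + 1}

/-- Directed spaghetti treewidth: minimal width of a directed spaghetti tree
decomposition. -/
noncomputable def dptw {V : Type} (G : SimpleGraph V) : ℕ :=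
  sInf {k | ∃ td : DirSpaghettiTD G, ∀ x, (td.bag x).ncard ≤ k + 1}

/-- Special treewidth: minimal width of a special tree decomposition. -/
noncomputable def spctw {V : Type} (G : SimpleGraph V) : ℕ :=
  sInf {k | ∃ td : SpecialTD G, ∀ x, (td.bag x).ncard ≤ k + 1}

/-- Pathwidth: minimal width of a path decomposition. -/
noncomputable def pw {V : Type} (G : SimpleGraph V) : ℕ :=
  sInf {k | ∃ pd : PathDecomp G, ∀ i, (pd.bag i).ncard ≤ k + 1}

/-- A graph is chordal iff it has no induced (i.e. chordless) cycle of length at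
least four. -/
def IsChordal {V : Type} (G : SimpleGraph V) : Prop :=
  ∀ (S : Set V) (n : ℕ), 4 ≤ n → ¬ Nonempty ((G.induce S) ≃g cycGraph n)

/-- A graph is strongly chordal if it is chordal and every even cycle of length at
least six has an odd chord: a chord splitting the cycle into two odd paths of
length at least three. -/
def IsStronglyChordal {V : Type} (G : SimpleGraph V) : Prop :=
  IsChordal G ∧ ∀ n : ℕ, 6 ≤ n → Even n → ∀ f : ZMod n → V,
    Function.Injective f → (∀ i : ZMod n, G.Adj (f i) (f (i + 1))) →
      ∃ (i : ZMod n) (d : ℕ), Odd d ∧ 3 ≤ d ∧ d + 3 ≤ n ∧ G.Adj (f i) (f (i + (d : ZMod n)))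

/-- Strongly chordal treewidth: the minimum of `ω(H) - 1` over all strongly chordal
supergraphs `H` of `G` (on the same vertex set; here `ω(H) ≤ k + 1` is expressed as
`H.CliqueFree (k + 2)`). -/
noncomputable def sctw {V : Type} (G : SimpleGraph V) : ℕ :=
  sInf {k | ∃ H : SimpleGraph V, G ≤ H ∧ IsStronglyChordal H ∧ H.CliqueFree (k + 2)}

/-- `H` is a minor of `G`: there is a family of nonempty, pairwise disjoint,
connected branch sets in `G`, one for each vertex of `H`, such that every edge of
`H` is realized by an edge of `G` between the corresponding branch sets. -/
def IsMinorOf {W V : Type} (H : SimpleGraph W) (G : SimpleGraph V) : Prop :=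
  ∃ f : W → Set V,
    (∀ w, (f w).Nonempty) ∧ (∀ w, (G.induce (f w)).Connected) ∧
    (Pairwise fun w w' => Disjoint (f w) (f w')) ∧
    ∀ ⦃w w'⦄, H.Adj w w' → ∃ u ∈ f w, ∃ v ∈ f w', G.Adj u v

/-- The complete graph on four vertices. -/
def K4 : SimpleGraph (Fin 4) := ⊤

/-- `D₃`: two vertices (`0` and `1`) joined by three internally vertex-disjoint
paths of length three. -/
def D3 : SimpleGraph (Fin 8) := SimpleGraph.fromRel (fun x y =>
  (x = 0 ∧ y = 2) ∨ (x = 2 ∧ y = 3) ∨ (x = 3 ∧ y = 1) ∨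
  (x = 0 ∧ y = 4) ∨ (x = 4 ∧ y = 5) ∨ (x = 5 ∧ y = 1) ∨
  (x = 0 ∧ y = 6) ∨ (x = 6 ∧ y = 7) ∨ (x = 7 ∧ y = 1))

/-- `S₃` (the 3-sun): a 6-cycle `0 1 2 3 4 5` together with the triangle `1 3 5`. -/
def S3 : SimpleGraph (Fin 6) := SimpleGraph.fromRel (fun x y =>
  (x = 0 ∧ y = 1) ∨ (x = 1 ∧ y = 2) ∨ (x = 2 ∧ y = 3) ∨ (x = 3 ∧ y = 4) ∨
  (x = 4 ∧ y = 5) ∨ (x = 5 ∧ y = 0) ∨ (x = 1 ∧ y = 3) ∨ (x = 3 ∧ y = 5) ∨ (x = 5 ∧ y = 1))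

/-- A graph is 2-connected if it has at least three vertices and deleting any one
vertex leaves it connected. -/
def TwoConnected {V : Type} (G : SimpleGraph V) : Prop :=
  3 ≤ Nat.card V ∧ ∀ v : V, (G.induce {x | x ≠ v}).Connected

/-- The cell completion of `G`: add an edge `vw` for every pair of (nonadjacent)
vertices `v, w` such that deleting `v` and `w` leaves at least three connected
components. -/
def cellCompletion {V : Type} (G : SimpleGraph V) : SimpleGraph V :=
  SimpleGraph.fromRel (fun v w => G.Adj v w ∨
    3 ≤ Nat.card ((G.induce {x | x ≠ v ∧ x ≠ w}).ConnectedComponent))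

/-- The induced subgraph of `G` on `S` has no cut vertex. -/
def NoCutVertex {V : Type} (G : SimpleGraph V) (S : Set V) : Prop :=
  ∀ v ∈ S, (S \ {v}).Nonempty → (G.induce (S \ {v})).Connected

/-- `S` carries a block of `G`: a maximal connected (induced) subgraph without a
cut vertex. -/
def IsBlock {V : Type} (G : SimpleGraph V) (S : Set V) : Prop :=
  S.Nonempty ∧ (G.induce S).Connected ∧ NoCutVertex G S ∧
    ∀ S' : Set V, S ⊆ S' → (G.induce S').Connected → NoCutVertex G S' → S' = S

/-- Glue a cycle of length `n` onto the graph `G` by identifying the cycle edge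
`{0, 1}` (with its end vertices) with the edge `{a, b}` of `G`. -/
def glueCycle {V : Type} (G : SimpleGraph V) (n : ℕ) (a b : V) :
    SimpleGraph (V ⊕ {x : ZMod n // x ≠ 0 ∧ x ≠ 1}) :=
  SimpleGraph.fromRel (fun p q =>
    match p, q with
    | Sum.inl u, Sum.inl v => G.Adj u v
    | Sum.inl u, Sum.inr x => (u = a ∧ (cycGraph n).Adj 0 x.1) ∨ (u = b ∧ (cycGraph n).Adj 1 x.1)
    | Sum.inr x, Sum.inr y => (cycGraph n).Adj x.1 y.1
    | Sum.inr _, Sum.inl _ => False)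

/-- The class of trees of cycles: every cycle is a tree of cycles, and gluing a
cycle onto a tree of cycles along an edge yields a tree of cycles (up to
isomorphism). -/
inductive IsTreeOfCycles : {V : Type} → SimpleGraph V → Prop
  | cycle {V : Type} (G : SimpleGraph V) (n : ℕ) (hn : 3 ≤ n)
      (e : Nonempty (G ≃g cycGraph n)) : IsTreeOfCycles G
  | glue {V W : Type} (G : SimpleGraph V) (hG : IsTreeOfCycles G)
      (n : ℕ) (hn : 3 ≤ n) (a b : V) (hab : G.Adj a b)
      (H : SimpleGraph W) (e : Nonempty (H ≃g glueCycle G n a b)) : IsTreeOfCycles H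

/-- `S` is the vertex set of a chordless cycle of `G`, i.e. it induces a cycle. -/
def IsChordlessCycle {V : Type} (G : SimpleGraph V) (S : Set V) : Prop :=
  ∃ n : ℕ, 3 ≤ n ∧ Nonempty ((G.induce S) ≃g cycGraph n)

/-- The edge `uv` is an edge separator: it lies in at least two distinct chordless
cycles of `G`. -/
def IsEdgeSeparator {V : Type} (G : SimpleGraph V) (u v : V) : Prop :=
  G.Adj u v ∧ ∃ S₁ S₂ : Set V, S₁ ≠ S₂ ∧ IsChordlessCycle G S₁ ∧ IsChordlessCycle G S₂ ∧
    u ∈ S₁ ∧ v ∈ S₁ ∧ u ∈ S₂ ∧ v ∈ S₂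

/-- `S` is a simplicial triangle of `G`: a chordless cycle on three vertices
containing a simplicial vertex of `G`. -/
def IsSimplicialTriangle {V : Type} (G : SimpleGraph V) (S : Set V) : Prop :=
  IsChordlessCycle G S ∧ S.ncard = 3 ∧ ∃ v ∈ S, G.IsClique (G.neighborSet v)

/-- A chain tree of cycles: a tree of cycles in which every edge lies in at most two
chordless cycles that are not simplicial triangles (equivalently, if an edge lies in
`m ≥ 3` chordless cycles then at least `m - 2` of them are simplicial triangles). -/
def IsChainTreeOfCycles {V : Type} (G : SimpleGraph V) : Prop :=
  IsTreeOfCycles G ∧ ∀ u v : V, G.Adj u v →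
    {S : Set V | IsChordlessCycle G S ∧ u ∈ S ∧ v ∈ S ∧ ¬ IsSimplicialTriangle G S}.ncard ≤ 2

/-- A tree of two-boundaried cycles: a tree of cycles in which every chordless
cycle contains at most two edge separators. -/
def IsTreeOfTwoBoundariedCycles {V : Type} (G : SimpleGraph V) : Prop :=
  IsTreeOfCycles G ∧ ∀ S : Set V, IsChordlessCycle G S →
    {e : Sym2 V | ∃ u v : V, e = s(u, v) ∧ u ∈ S ∧ v ∈ S ∧ IsEdgeSeparator G u v}.ncard ≤ 2

/-- A path of cycles: a tree of cycles in which every chordless cycle contains at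
most two edge separators and every edge lies in at most two chordless cycles that
are not simplicial triangles. -/
def IsPathOfCycles {V : Type} (G : SimpleGraph V) : Prop :=
  IsTreeOfCycles G ∧
    (∀ S : Set V, IsChordlessCycle G S →
      {e : Sym2 V | ∃ u v : V, e = s(u, v) ∧ u ∈ S ∧ v ∈ S ∧ IsEdgeSeparator G u v}.ncard ≤ 2) ∧
    ∀ u v : V, G.Adj u v →
      {S : Set V | IsChordlessCycle G S ∧ u ∈ S ∧ v ∈ S ∧ ¬ IsSimplicialTriangle G S}.ncard ≤ 2

/-- The graph is a single edge. -/
def IsSingleEdgeGraph {V : Type} (G : SimpleGraph V) : Prop :=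
  Nat.card V = 2 ∧ ∀ a b : V, a ≠ b → G.Adj a b

/-- A mamba: a 2-connected graph of pathwidth two, a single edge, or an isolated
vertex. -/
def IsMamba {V : Type} (G : SimpleGraph V) : Prop :=
  (TwoConnected G ∧ pw G = 2) ∨ IsSingleEdgeGraph G ∨ Nat.card V = 1

/-- `v` is a head vertex of the mamba `G`: some path decomposition of `G` of width
at most two has `v` in its first bag. -/
def IsHeadVertex {V : Type} (G : SimpleGraph V) (v : V) : Prop :=
  ∃ pd : PathDecomp G, (∀ i, (pd.bag i).ncard ≤ 3) ∧ v ∈ pd.bag ⟨0, pd.hm⟩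

/-- Glue the graph `M` onto the graph `G` by identifying the vertex `h` of `M` with
the vertex `x` of `G`. -/
def glueAtVertex {V W : Type} (G : SimpleGraph V) (x : V) (M : SimpleGraph W) (h : W) :
    SimpleGraph (V ⊕ {w : W // w ≠ h}) :=
  SimpleGraph.fromRel (fun p q =>
    match p, q with
    | Sum.inl u, Sum.inl u' => G.Adj u u'
    | Sum.inl u, Sum.inr w => u = x ∧ M.Adj h w.1
    | Sum.inr w, Sum.inr w' => M.Adj w.1 w'.1
    | Sum.inr _, Sum.inl _ => False)

/-- The class of mamba trees: every mamba is a mamba tree, and gluing a mamba onto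
a mamba tree by identifying a vertex of the mamba tree with a head vertex of the
mamba yields a mamba tree (up to isomorphism). -/
inductive IsMambaTree : {V : Type} → SimpleGraph V → Prop
  | mamba {V : Type} (G : SimpleGraph V) (hG : IsMamba G) : IsMambaTree G
  | glue {V W U : Type} (G : SimpleGraph V) (hG : IsMambaTree G)
      (M : SimpleGraph W) (hM : IsMamba M) (x : V) (h : W) (hh : IsHeadVertex M h)
      (K : SimpleGraph U) (e : Nonempty (K ≃g glueAtVertex G x M h)) : IsMambaTree K

/-- Subdivide the edge `{a, b}` of `G` by a new vertex. -/
def subdivideEdge {V : Type} (G : SimpleGraph V) (a b : V) : SimpleGraph (V ⊕ Unit) :=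
  SimpleGraph.fromRel (fun p q =>
    match p, q with
    | Sum.inl u, Sum.inl v => G.Adj u v ∧ ¬(u = a ∧ v = b) ∧ ¬(u = b ∧ v = a)
    | Sum.inl u, Sum.inr _ => u = a ∨ u = b
    | Sum.inr _, _ => False)

/-- `H` is a subdivision of `G`: `H` is obtained from (an isomorphic copy of) `G`
by repeatedly subdividing edges. -/
inductive IsSubdivisionOf : {W V : Type} → SimpleGraph W → SimpleGraph V → Prop
  | base {V W : Type} {G : SimpleGraph V} {H : SimpleGraph W}
      (e : Nonempty (H ≃g G)) : IsSubdivisionOf H G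
  | step {V W U : Type} {G : SimpleGraph V} {H : SimpleGraph W} (a b : W) (hab : H.Adj a b)
      (h : IsSubdivisionOf H G) {K : SimpleGraph U}
      (e : Nonempty (K ≃g subdivideEdge H a b)) : IsSubdivisionOf K G

/-- Contract the edge `{a, b}` of `G` (the contracted vertex is `a`, `b` is removed). -/
def contractEdge {V : Type} (G : SimpleGraph V) (a b : V) : SimpleGraph {x : V // x ≠ b} :=
  SimpleGraph.fromRel (fun x y =>
    G.Adj x.1 y.1 ∨ (x.1 = a ∧ G.Adj b y.1) ∨ (y.1 = a ∧ G.Adj b x.1))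

/-! ### Connected vertex sets, described by cuts -/

/-- `S` is nonempty and every splitting of `S` into two nonempty parts is crossed by an edge. -/
def ConnOn {V : Type} (G : SimpleGraph V) (S : Set V) : Prop :=
  S.Nonempty ∧ ∀ K : Set V, (∃ p ∈ S, p ∈ K) → (∃ q ∈ S, q ∉ K) →
    ∃ u ∈ S, u ∈ K ∧ ∃ v ∈ S, v ∉ K ∧ G.Adj u v

section Connectivity

variable {V : Type} {G : SimpleGraph V}

lemma connOn_iff_connected_induce (S : Set V) : (G.induce S).Connected ↔ ConnOn G S := by
  constructor
  · intro h
    refine ⟨Set.nonempty_coe_sort.1 h.nonempty, ?_⟩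
    rintro K ⟨p, hp, hpK⟩ ⟨q, hq, hqK⟩
    obtain ⟨w⟩ := h.preconnected ⟨p, hp⟩ ⟨q, hq⟩
    obtain ⟨d, -, hd1, hd2⟩ := w.exists_boundary_dart {x | x.1 ∈ K} hpK hqK
    exact ⟨d.fst.1, d.fst.2, hd1, d.snd.1, d.snd.2, hd2, d.adj⟩
  · rintro ⟨⟨p, hp⟩, h⟩
    have : Nonempty S := ⟨⟨p, hp⟩⟩
    refine ⟨fun x y => ?_⟩
    by_contra hxy
    obtain ⟨u, hu, ⟨hu', hr⟩, v, hv, hvK, huv⟩ := h {z | ∃ hz : z ∈ S, (G.induce S).Reachable x ⟨z, hz⟩}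
      ⟨x, x.2, x.2, Reachable.refl _⟩ ⟨y, y.2, fun ⟨_, h⟩ => hxy h⟩
    exact hvK ⟨hv, hr.trans (Adj.reachable (by simpa using huv))⟩

lemma ConnOn.singleton (x : V) : ConnOn G {x} :=
  ⟨⟨x, rfl⟩, by rintro K ⟨p, rfl, hp⟩ ⟨q, rfl, hq⟩; exact absurd hp hq⟩

lemma ConnOn.union {A B : Set V} (hA : ConnOn G A) (hB : ConnOn G B) {a b : V} (ha : a ∈ A)
    (hb : b ∈ B) (hab : a = b ∨ G.Adj a b) : ConnOn G (A ∪ B) := by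
  refine ⟨⟨a, Or.inl ha⟩, ?_⟩
  rintro K ⟨p, hp, hpK⟩ ⟨q, hq, hqK⟩
  by_cases h1 : (∃ p ∈ A, p ∈ K) ∧ ∃ q ∈ A, q ∉ K
  · obtain ⟨u, hu, huK, v, hv, hvK, huv⟩ := hA.2 K h1.1 h1.2
    exact ⟨u, Or.inl hu, huK, v, Or.inl hv, hvK, huv⟩
  by_cases h2 : (∃ p ∈ B, p ∈ K) ∧ ∃ q ∈ B, q ∉ K
  · obtain ⟨u, hu, huK, v, hv, hvK, huv⟩ := hB.2 K h2.1 h2.2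
    exact ⟨u, Or.inr hu, huK, v, Or.inr hv, hvK, huv⟩
  rcases hab with rfl | hab
  · grind
  by_cases haK : a ∈ K
  · exact ⟨a, Or.inl ha, haK, b, Or.inr hb, by grind, hab⟩
  · exact ⟨b, Or.inr hb, by grind, a, Or.inl ha, haK, hab.symm⟩

lemma ConnOn.insert {A : Set V} (hA : ConnOn G A) {a b : V} (hb : b ∈ A) (hab : G.Adj a b) :
    ConnOn G (insert a A) :=
  (ConnOn.singleton a).union hA rfl hb (Or.inr hab)

/-- The connected component of `x` in the graph induced by `U`. -/
lemma exists_component {U : Set V} {x : V} (hx : x ∈ U) :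
    ∃ K ⊆ U, x ∈ K ∧ ConnOn G K ∧ ∀ u ∈ K, ∀ v ∈ U, G.Adj u v → v ∈ K := by
  refine ⟨{y | ∃ A ⊆ U, ConnOn G A ∧ x ∈ A ∧ y ∈ A}, ?_, ?_, ⟨⟨x, ?_⟩, ?_⟩, ?_⟩
  · rintro y ⟨A, hA, -, -, hy⟩
    exact hA hy
  · exact ⟨{x}, by simpa, .singleton x, rfl, rfl⟩
  · exact ⟨{x}, by simpa, .singleton x, rfl, rfl⟩
  · rintro K ⟨p, ⟨A, hA, hAc, hxA, hpA⟩, hpK⟩ ⟨q, ⟨B, hB, hBc, hxB, hqB⟩, hqK⟩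
    obtain ⟨u, hu, huK, v, hv, hvK, huv⟩ := (hAc.union hBc hxA hxB (.inl rfl)).2 K
      ⟨p, .inl hpA, hpK⟩ ⟨q, .inr hqB, hqK⟩
    have h := hAc.union hBc hxA hxB (.inl rfl)
    exact ⟨u, ⟨_, Set.union_subset hA hB, h, .inl hxA, hu⟩, huK, v,
      ⟨_, Set.union_subset hA hB, h, .inl hxA, hv⟩, hvK, huv⟩
  · rintro u ⟨A, hA, hAc, hxA, huA⟩ v hv huv
    exact ⟨insert v A, Set.insert_subset hv hA, hAc.insert huA huv.symm, .inr hxA, .inl rfl⟩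

/-- A connected set meets one side of a single-edge cut in a connected set. -/
lemma ConnOn.inter_of_cut {P X : Set V} {x : V} (hP : ConnOn G P)
    (hX : ∀ u ∈ P ∩ X, ∀ v ∈ P \ X, G.Adj u v → u = x) (hne : (P ∩ X).Nonempty) :
    ConnOn G (P ∩ X) := by
  refine ⟨hne, ?_⟩
  have key : ∀ K : Set V, x ∈ K → (∃ p ∈ P ∩ X, p ∈ K) → (∃ q ∈ P ∩ X, q ∉ K) →
      ∃ u ∈ P ∩ X, u ∈ K ∧ ∃ v ∈ P ∩ X, v ∉ K ∧ G.Adj u v := by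
    rintro K hx ⟨p, hp, hpK⟩ ⟨q, hq, hqK⟩
    obtain ⟨u, hu, huJ, v, hv, hvJ, huv⟩ := hP.2 ((P ∩ X) \ K) ⟨q, hq.1, hq, hqK⟩
      ⟨p, hp.1, fun h => h.2 hpK⟩
    have hvX : v ∈ X := by
      by_contra hvX
      exact huJ.2 (hX u huJ.1 v ⟨hv, hvX⟩ huv ▸ hx)
    exact ⟨v, ⟨hv, hvX⟩, by_contra fun h => hvJ ⟨⟨hv, hvX⟩, h⟩, u, huJ.1, huJ.2, huv.symm⟩
  intro K hp hq
  by_cases hx : x ∈ K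
  · exact key K hx hp hq
  · obtain ⟨u, hu, huK, v, hv, hvK, huv⟩ := key Kᶜ hx hq (by simpa using hp)
    exact ⟨v, hv, by simpa using hvK, u, hu, huK, huv.symm⟩

/-- If no vertex of `C` separates `A` from `B` then there are two disjoint connected sets
meeting both `A` and `B`. -/
lemma exists_two_disjoint_connOn [Finite V] (B : Set V) : ∀ (n : ℕ) (C A : Set V), C.ncard = n →
    C.Nonempty → (∀ c ∈ C, ∃ P ⊆ C \ {c}, ConnOn G P ∧ (∃ x ∈ P, x ∈ A) ∧ ∃ y ∈ P, y ∈ B) →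
    ∃ Y ⊆ C, ∃ Z ⊆ C, Disjoint Y Z ∧ ConnOn G Y ∧ ConnOn G Z ∧ (∃ x ∈ Y, x ∈ A) ∧
      (∃ y ∈ Y, y ∈ B) ∧ (∃ x ∈ Z, x ∈ A) ∧ ∃ y ∈ Z, y ∈ B := by
  intro n
  induction n using Nat.strong_induction_on with
  | _ n ih =>
  rintro C A rfl ⟨c, hc⟩ h
  obtain ⟨P, hPC, hP, ⟨x, hxP, hxA⟩, y, hyP, hyB⟩ := h c hc
  have hxC : x ∈ C := (hPC hxP).1
  obtain ⟨Q, hQC, hQ, ⟨s, hsQ, hsA⟩, t, htQ, htB⟩ := h x hxC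
  by_cases hxB : x ∈ B
  · exact ⟨{x}, by simpa, Q, hQC.trans Set.sdiff_subset, by
      rw [Set.disjoint_singleton_left]; exact fun h => (hQC h).2 rfl, .singleton x, hQ,
      ⟨x, rfl, hxA⟩, ⟨x, rfl, hxB⟩, ⟨s, hsQ, hsA⟩, t, htQ, htB⟩
  obtain ⟨Y, hYC, Z, hZC, hYZ, hY, hZ, hYA, hYB, hZA, hZB⟩ := ih (C \ {x}).ncard
    (Set.ncard_sdiff_singleton_lt_of_mem hxC) (C \ {x}) (A ∪ {v | G.Adj x v}) rfl
    ⟨s, hQC hsQ⟩ (by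
      intro d hd
      obtain ⟨R, hRC, hR, ⟨p, hpR, hpA⟩, q, hqR, hqB⟩ := h d hd.1
      have hqx : q ≠ x := by rintro rfl; exact hxB hqB
      obtain ⟨K, hKU, hqK, hK, hKc⟩ := exists_component (G := G) (U := R \ {x}) ⟨hqR, hqx⟩
      refine ⟨K, fun z hz => ⟨⟨(hRC (hKU hz).1).1, (hKU hz).2⟩, (hRC (hKU hz).1).2⟩, hK, ?_,
        q, hqK, hqB⟩
      by_cases hpK : p ∈ K
      · exact ⟨p, hpK, .inl hpA⟩
      · obtain ⟨u, hu, huK, v, hv, hvK, huv⟩ := hR.2 K ⟨q, hqR, hqK⟩ ⟨p, hpR, hpK⟩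
        have : v = x := by
          by_contra hvx
          exact hvK (hKc u huK v ⟨hv, hvx⟩ huv)
        exact ⟨u, huK, .inr (this ▸ huv.symm)⟩)
  have main : ∀ Y ⊆ C \ {x}, ∀ Z ⊆ C \ {x}, Disjoint Y Z → ConnOn G Y → ConnOn G Z →
      (∃ p ∈ Y, p ∈ A) → (∃ q ∈ Y, q ∈ B) → (∃ p ∈ Z, p ∈ A ∪ {v | G.Adj x v}) →
      (∃ q ∈ Z, q ∈ B) → ∃ Y ⊆ C, ∃ Z ⊆ C, Disjoint Y Z ∧ ConnOn G Y ∧ ConnOn G Z ∧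
      (∃ x ∈ Y, x ∈ A) ∧ (∃ y ∈ Y, y ∈ B) ∧ (∃ x ∈ Z, x ∈ A) ∧ ∃ y ∈ Z, y ∈ B := by
    rintro Y hYC Z hZC hYZ hY hZ hYA hYB ⟨p, hpZ, hp⟩ ⟨q, hqZ, hqB⟩
    rcases hp with hp | hp
    · exact ⟨Y, hYC.trans Set.sdiff_subset, Z, hZC.trans Set.sdiff_subset, hYZ, hY, hZ, hYA, hYB,
        ⟨p, hpZ, hp⟩, q, hqZ, hqB⟩
    · refine ⟨Y, hYC.trans Set.sdiff_subset, insert x Z, Set.insert_subset hxC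
        (hZC.trans Set.sdiff_subset), ?_, hY, hZ.insert hpZ hp, hYA, hYB, ⟨x, .inl rfl, hxA⟩,
        q, .inr hqZ, hqB⟩
      rw [Set.disjoint_insert_right]
      exact ⟨fun h => (hYC h).2 rfl, hYZ⟩
  by_cases h1 : ∃ p ∈ Y, p ∈ A
  · exact main Y hYC Z hZC hYZ hY hZ h1 hYB hZA hZB
  by_cases h2 : ∃ p ∈ Z, p ∈ A
  · exact main Z hZC Y hYC hYZ.symm hZ hY h2 hZB hYA hYB
  obtain ⟨K, hKU, hsK, hK, hKc⟩ := exists_component (G := G) (U := Q \ (Y ∪ Z)) (x := s)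
    ⟨hsQ, by rintro (h | h); exacts [h1 ⟨s, h, hsA⟩, h2 ⟨s, h, hsA⟩]⟩
  have hKC : K ⊆ C \ {x} := fun z hz => hQC (hKU hz).1
  have hKY : Disjoint K Y := Set.disjoint_left.2 fun z hz hz' => (hKU hz).2 (.inl hz')
  have hKZ : Disjoint K Z := Set.disjoint_left.2 fun z hz hz' => (hKU hz).2 (.inr hz')
  by_cases h3 : ∃ q ∈ K, q ∈ B
  · exact main K hKC Y hYC hKY hK hY ⟨s, hsK, hsA⟩ h3 hYA hYB
  obtain ⟨u, hu, huK, v, hv, hvK, huv⟩ := hQ.2 K ⟨s, hsQ, hsK⟩ ⟨t, htQ, fun h => h3 ⟨t, h, htB⟩⟩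
  have hvYZ : v ∈ Y ∪ Z := by
    by_contra hvYZ
    exact hvK (hKc u huK v ⟨hv, hvYZ⟩ huv)
  rcases hvYZ with hvY | hvZ
  · obtain ⟨q, hq, hqB⟩ := hYB
    exact main (K ∪ Y) (Set.union_subset hKC hYC) Z hZC (Set.disjoint_union_left.2 ⟨hKZ, hYZ⟩)
      (hK.union hY huK hvY (.inr huv)) hZ ⟨s, .inl hsK, hsA⟩ ⟨q, .inr hq, hqB⟩ hZA hZB
  · obtain ⟨q, hq, hqB⟩ := hZB
    exact main (K ∪ Z) (Set.union_subset hKC hZC) Y hYC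
      (Set.disjoint_union_left.2 ⟨hKY, hYZ.symm⟩)
      (hK.union hZ huK hvZ (.inr huv)) hY ⟨s, .inl hsK, hsA⟩ ⟨q, .inr hq, hqB⟩ hYA hYB

/-- If `b` has two neighbours in the connected set `Q ∋ c`, then one of them, `y`, can be split
off so that the component `K` of `c` in the rest is still adjacent to `b`. -/
lemma ConnOn.exists_split [Finite V] {Q : Set V} (hQ : ConnOn G Q) {b c : V} (hc : c ∈ Q)
    (hb : ∀ v ∈ Q, ∃ u ∈ Q, G.Adj b u ∧ u ≠ v) :
    ∃ y ∈ Q, ∃ K ⊆ Q, y ∉ K ∧ c ∈ K ∧ ConnOn G K ∧ G.Adj b y ∧ (∃ x ∈ K, G.Adj b x) ∧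
      ∃ z ∈ K, G.Adj y z := by
  obtain ⟨y₀, hy₀, hby₀, hy₀c⟩ := hb c hc
  obtain ⟨K₀, hK₀, hcK₀, hcon₀, -⟩ := exists_component (G := G) (U := Q \ {y₀}) ⟨hc, hy₀c.symm⟩
  let F : Set (Set V) := {K | c ∈ K ∧ ConnOn G K ∧ ∃ y ∈ Q, G.Adj b y ∧ K ⊆ Q \ {y}}
  obtain ⟨K, hKF, hmax⟩ := (Set.toFinite F).exists_maximalFor Set.ncard F
    ⟨K₀, hcK₀, hcon₀, y₀, hy₀, hby₀, hK₀⟩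
  obtain ⟨hcK, hK, y, hy, hby, hKQ⟩ := hKF
  have hyK : y ∉ K := fun h => (hKQ h).2 rfl
  have big : ∀ K' ∈ F, ¬ K ⊂ K' := fun K' hK' hlt =>
    absurd (hmax hK' (Set.ncard_le_ncard hlt.1)) (not_le.2 (Set.ncard_lt_ncard hlt))
  have hyz : ∃ z ∈ K, G.Adj y z := by
    obtain ⟨u, hu, huK, v, hv, hvK, huv⟩ := hQ.2 K ⟨c, hc, hcK⟩ ⟨y, hy, hyK⟩
    by_contra hcon
    refine big (Insert.insert v K) ⟨.inr hcK, hK.insert huK huv.symm, y, hy, hby, ?_⟩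
      (Set.ssubset_insert hvK)
    refine Set.insert_subset ⟨hv, ?_⟩ hKQ
    rintro rfl
    exact hcon ⟨u, huK, huv.symm⟩
  refine ⟨y, hy, K, fun z hz => (hKQ hz).1, hyK, hcK, hK, hby, ?_, hyz⟩
  by_contra hcon
  obtain ⟨x, hx, hbx, hxy⟩ := hb y hy
  obtain ⟨z, hz, hyz⟩ := hyz
  refine big (Insert.insert y K) ⟨.inr hcK, hK.insert hz hyz, x, hx, hbx, ?_⟩
    (Set.ssubset_insert hyK)
  refine Set.insert_subset ⟨hy, hxy.symm⟩ fun w hw => ⟨(hKQ hw).1, ?_⟩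
  rintro rfl
  exact hcon ⟨w, hw, hbx⟩

end Connectivity

/-! ### Path decompositions as interval representations -/

/-- The graph induced by `S` has a path decomposition with bags of size at most `k` whose last bag
contains `X`; the vertex `v` occupies the interval `[l v, r v]`. -/
def PathRep {V : Type} (G : SimpleGraph V) (S X : Set V) (k : ℕ) : Prop :=
  ∃ (l r : V → ℤ) (N : ℤ), (∀ v ∈ S, l v ≤ r v ∧ r v ≤ N) ∧ (∀ v ∈ X, r v = N) ∧
    (∀ u ∈ S, ∀ v ∈ S, G.Adj u v → l u ≤ r v) ∧
    ∀ t : ℤ, {v | v ∈ S ∧ l v ≤ t ∧ t ≤ r v}.ncard ≤ k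

/-- The graph induced by `S` is 2-connected. -/
def TwoConnOn {V : Type} (G : SimpleGraph V) (S : Set V) : Prop :=
  3 ≤ S.ncard ∧ ∀ v ∈ S, ConnOn G (S \ {v})

section PathRep

variable {V : Type} {G : SimpleGraph V}

lemma PathRep.mono_last {S X Y : Set V} {k : ℕ} (h : PathRep G S X k) (hY : Y ⊆ X) :
    PathRep G S Y k := by
  obtain ⟨l, r, N, h1, h2, h3⟩ := h
  exact ⟨l, r, N, h1, fun v hv => h2 v (hY hv), h3⟩

lemma pathRep_pair [Finite V] (a b : V) : PathRep G {a, b} {a, b} 3 :=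
  ⟨fun _ => 0, fun _ => 0, 0, by simp, by simp, by simp, fun t =>
    (Set.ncard_le_ncard (fun _ h => h.1)).trans ((Set.ncard_insert_le a {b}).trans (by simp))⟩

lemma PathRep.append [Finite V] {S X Y : Set V} {v : V} (h : PathRep G S X 3)
    (hX : X.ncard ≤ 2) (hv : v ∉ S) (hadj : ∀ u ∈ S, G.Adj v u → u ∈ X)
    (hY : Y ⊆ insert v X) : PathRep G (insert v S) Y 3 := by
  classical
  obtain ⟨l, r, N, h1, h2, h3, h4⟩ := h
  refine PathRep.mono_last (X := insert v X) ⟨fun w => if w = v then N + 1 else l w,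
    fun w => if w = v ∨ w ∈ X then N + 1 else r w, N + 1, ?_, ?_, ?_, ?_⟩ hY
  · grind
  · grind
  · rintro u (rfl | hu) w (rfl | hw) huw
    · grind
    · have : w ∈ X := hadj w hw huw
      grind
    · grind
    · have := h3 u hu w hw huw
      grind
  · intro t
    by_cases ht : t ≤ N
    · refine le_trans (Set.ncard_le_ncard ?_) (h4 t)
      rintro w ⟨rfl | hw, h5, h6⟩
      · grind
      · refine ⟨hw, ?_⟩
        grind
    · refine le_trans (Set.ncard_le_ncard (t := insert v X) ?_)
        ((Set.ncard_insert_le v X).trans (by omega))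
      rintro w ⟨rfl | hw, h5, h6⟩
      · grind
      · grind

lemma PathRep.concat [Finite V] {A B : Set V} {a b : V} {k : ℕ} (hA : PathRep G A {a, b} k)
    (hB : PathRep G B {a, b} k) (haA : a ∈ A) (hbA : b ∈ A) (haB : a ∈ B) (hbB : b ∈ B)
    (hAB : ∀ x ∈ A, x ∈ B → x = a ∨ x = b)
    (hadj : ∀ u ∈ A, ∀ v ∈ B, G.Adj u v → u ∈ B ∨ v ∈ A) : PathRep G (A ∪ B) ∅ k := by
  classical
  obtain ⟨l, r, N, h1, h2, h3, h4⟩ := hA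
  obtain ⟨l', r', N', h1', h2', h3', h4'⟩ := hB
  obtain ⟨M, hM⟩ := (Set.finite_range fun w => 1 - (l' w - N')).bddAbove
  have hM' : ∀ w, 1 - (l' w - N') ≤ M := fun w => hM ⟨w, rfl⟩
  have hra : r a = N := h2 a (by simp)
  have hrb : r b = N := h2 b (by simp)
  have hra' : r' a = N' := h2' a (by simp)
  have hrb' : r' b = N' := h2' b (by simp)
  refine ⟨fun w => if w ∈ A then l w - N else 1 - (r' w - N'),
    fun w => if w ∈ B then 1 - (l' w - N') else r w - N, max M 0, ?_, by simp, ?_, ?_⟩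
  · intro v hv
    have := hM' v
    by_cases hvA : v ∈ A <;> by_cases hvB : v ∈ B
    · have := h1 v hvA; have := h1' v hvB
      simp only [hvA, hvB, if_true]; omega
    · have := h1 v hvA
      simp only [hvA, hvB, if_true, if_false]; omega
    · have := h1' v hvB
      simp only [hvA, hvB, if_true, if_false]; omega
    · exact absurd hv (by simp [hvA, hvB])
  · have cross : ∀ u ∈ A, ∀ v ∈ B, l u - N ≤ 1 - (l' v - N') := by
      intro u hu v hv
      have := h1 u hu; have := h1' v hv
      omega
    intro u hu v hv huv
    by_cases huA : u ∈ A <;> by_cases hvB : v ∈ B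
    · simp only [huA, hvB, if_true]
      exact cross u huA v hvB
    · have hvA : v ∈ A := hv.resolve_right hvB
      have := h3 u huA v hvA huv
      simp only [huA, hvB, if_true, if_false]; omega
    · have huB : u ∈ B := hu.resolve_left huA
      have := h3' v hvB u huB huv.symm
      simp only [huA, hvB, if_true, if_false]; omega
    · rcases hadj v (hv.resolve_right hvB) u (hu.resolve_left huA) huv.symm with h | h
      · exact absurd h hvB
      · exact absurd h huA
  · intro t
    by_cases ht : t ≤ 0
    · refine le_trans (Set.ncard_le_ncard ?_) (h4 (t + N))
      rintro w ⟨hw, h5, h6⟩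
      by_cases hwA : w ∈ A
      · refine ⟨hwA, ?_⟩
        have := h1 w hwA
        by_cases hwB : w ∈ B
        · rcases hAB w hwA hwB with rfl | rfl <;> simp only [hwA, hwB, if_true] at h5 h6 <;> omega
        · simp only [hwA, hwB, if_true, if_false] at h5 h6; omega
      · have := h1' w (hw.resolve_left hwA)
        simp only [hwA, if_false] at h5; omega
    · refine le_trans (Set.ncard_le_ncard ?_) (h4' (1 - t + N'))
      rintro w ⟨hw, h5, h6⟩
      by_cases hwB : w ∈ B
      · refine ⟨hwB, ?_⟩
        have := h1' w hwB
        by_cases hwA : w ∈ A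
        · rcases hAB w hwA hwB with rfl | rfl <;> simp only [hwA, hwB, if_true] at h5 h6 <;> omega
        · simp only [hwA, hwB, if_true, if_false] at h5 h6; omega
      · have := h1 w (hw.resolve_right hwB)
        simp only [hwB, if_false] at h6; omega

lemma TwoConnOn.cross {S : Set V} (h : TwoConnOn G S) {x : V} (hx : x ∈ S) (K : Set V)
    (hp : ∃ p ∈ S, p ∈ K ∧ p ≠ x) (hq : ∃ q ∈ S, q ∉ K ∧ q ≠ x) :
    ∃ u ∈ S, u ∈ K ∧ u ≠ x ∧ ∃ v ∈ S, v ∉ K ∧ v ≠ x ∧ G.Adj u v := by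
  obtain ⟨p, hp, hpK, hpx⟩ := hp
  obtain ⟨q, hq, hqK, hqx⟩ := hq
  obtain ⟨u, hu, huK, v, hv, hvK, huv⟩ := (h.2 x hx).2 K ⟨p, ⟨hp, hpx⟩, hpK⟩ ⟨q, ⟨hq, hqx⟩, hqK⟩
  exact ⟨u, hu.1, huK, hu.2, v, hv.1, hvK, hv.2, huv⟩

lemma TwoConnOn.connOn {S : Set V} (h : TwoConnOn G S) : ConnOn G S := by
  obtain ⟨a, b, c, ha, hb, hc, hab, hac, hbc⟩ := (Set.two_lt_ncard_iff (Set.finite_of_ncard_pos (by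
    have := h.1; omega))).1 h.1
  have h1 := (h.2 a ha).union (h.2 b hb) ⟨hc, hac.symm⟩ ⟨hc, hbc.symm⟩ (.inl rfl)
  convert h1 using 1
  grind

end PathRep

/-! ### Minors inside a vertex set -/

/-- A model of the graph `H` as a minor of `G`, with all branch sets contained in `S`. -/
def MinorOn {W V : Type} (H : SimpleGraph W) (G : SimpleGraph V) (S : Set V) : Prop :=
  ∃ f : W → Set V, (∀ w, ConnOn G (f w)) ∧ (∀ w, f w ⊆ S) ∧
    (Pairwise fun w w' => Disjoint (f w) (f w')) ∧
    ∀ ⦃w w'⦄, H.Adj w w' → ∃ u ∈ f w, ∃ v ∈ f w', G.Adj u v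

section Minor

variable {W V : Type} {H : SimpleGraph W} {G : SimpleGraph V}

lemma isMinorOf_iff_minorOn : IsMinorOf H G ↔ MinorOn H G Set.univ := by
  simp only [IsMinorOf, MinorOn, connOn_iff_connected_induce, Set.subset_univ, implies_true,
    true_and]
  exact ⟨fun ⟨f, _, h⟩ => ⟨f, h⟩, fun ⟨f, h⟩ => ⟨f, fun w => (h.1 w).1, h⟩⟩

lemma MinorOn.mono {S S' : Set V} (h : MinorOn H G S) (hS : S ⊆ S') : MinorOn H G S' := by
  obtain ⟨f, h1, h2, h3⟩ := h
  exact ⟨f, h1, fun w => (h2 w).trans hS, h3⟩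

lemma MinorOn.fromRel {rel : W → W → Prop} {S : Set V} (f : W → Set V)
    (hc : ∀ w, ConnOn G (f w)) (hS : ∀ w, f w ⊆ S)
    (hd : Pairwise fun w w' => Disjoint (f w) (f w'))
    (he : ∀ w w', rel w w' → ∃ u ∈ f w, ∃ v ∈ f w', G.Adj u v) :
    MinorOn (SimpleGraph.fromRel rel) G S := by
  refine ⟨f, hc, hS, hd, ?_⟩
  rintro w w' ⟨-, h | h⟩
  · exact he w w' h
  · obtain ⟨u, hu, v, hv, huv⟩ := he w' w h
    exact ⟨v, hv, u, hu, huv.symm⟩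

/-- There is an edge between `A` and `B`. -/
def Touch (G : SimpleGraph V) (A B : Set V) : Prop := ∃ u ∈ A, ∃ v ∈ B, G.Adj u v

lemma Touch.symm {A B : Set V} (h : Touch G A B) : Touch G B A :=
  let ⟨u, hu, v, hv, huv⟩ := h
  ⟨v, hv, u, hu, huv.symm⟩

lemma Touch.mono {A B A' B' : Set V} (h : Touch G A B) (hA : A ⊆ A') (hB : B ⊆ B') :
    Touch G A' B' :=
  let ⟨u, hu, v, hv, huv⟩ := h
  ⟨u, hA hu, v, hB hv, huv⟩

lemma minorOn_K4 {S A B C D : Set V} (hA : ConnOn G A) (hB : ConnOn G B) (hC : ConnOn G C)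
    (hD : ConnOn G D) (hS : A ∪ B ∪ C ∪ D ⊆ S)
    (hAB : Disjoint A B) (hAC : Disjoint A C) (hAD : Disjoint A D) (hBC : Disjoint B C)
    (hBD : Disjoint B D) (hCD : Disjoint C D) (eAB : Touch G A B) (eAC : Touch G A C)
    (eAD : Touch G A D) (eBC : Touch G B C) (eBD : Touch G B D) (eCD : Touch G C D) :
    MinorOn K4 G S := by
  simp only [Set.union_subset_iff] at hS
  refine ⟨![A, B, C, D], ?_, ?_, ?_, ?_⟩
  · intro w; fin_cases w <;> assumption
  · intro w; fin_cases w <;> simp [hS]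
  · intro w w' h
    fin_cases w <;> fin_cases w' <;> first | exact absurd rfl h | assumption | (symm; assumption)
  · intro w w' h
    have h := h.ne
    fin_cases w <;> fin_cases w' <;>
      first | exact absurd rfl h | assumption | (apply Touch.symm; assumption)

/-- The triangle `X, Y, Z` with the ears `P, Q, R` contains the 3-sun. -/
lemma minorOn_S3 {S X Y Z P Q R : Set V} (hX : ConnOn G X) (hY : ConnOn G Y) (hZ : ConnOn G Z)
    (hP : ConnOn G P) (hQ : ConnOn G Q) (hR : ConnOn G R) (hS : X ∪ Y ∪ Z ∪ P ∪ Q ∪ R ⊆ S)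
    (dXY : Disjoint X Y) (dXZ : Disjoint X Z) (dYZ : Disjoint Y Z)
    (dP : Disjoint P (X ∪ Y ∪ Z)) (dQ : Disjoint Q (X ∪ Y ∪ Z)) (dR : Disjoint R (X ∪ Y ∪ Z))
    (dPQ : Disjoint P Q) (dPR : Disjoint P R) (dQR : Disjoint Q R)
    (eXY : Touch G X Y) (eXZ : Touch G X Z) (eYZ : Touch G Y Z) (ePX : Touch G P X)
    (ePY : Touch G P Y) (eQY : Touch G Q Y) (eQZ : Touch G Q Z) (eRX : Touch G R X)
    (eRZ : Touch G R Z) : MinorOn S3 G S := by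
  simp only [Set.union_subset_iff] at hS
  simp only [Set.disjoint_union_right] at dP dQ dR
  obtain ⟨⟨dPX, dPY⟩, dPZ⟩ := dP
  obtain ⟨⟨dQX, dQY⟩, dQZ⟩ := dQ
  obtain ⟨⟨dRX, dRY⟩, dRZ⟩ := dR
  refine MinorOn.fromRel ![P, X, R, Z, Q, Y] ?_ ?_ ?_ ?_
  · intro w; fin_cases w <;> assumption
  · intro w; fin_cases w <;> simp [hS]
  · intro w w' h
    fin_cases w <;> fin_cases w' <;> first | exact absurd rfl h | assumption | (symm; assumption)
  · rintro w w' (⟨rfl, rfl⟩ | ⟨rfl, rfl⟩ | ⟨rfl, rfl⟩ | ⟨rfl, rfl⟩ | ⟨rfl, rfl⟩ | ⟨rfl, rfl⟩ |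
      ⟨rfl, rfl⟩ | ⟨rfl, rfl⟩ | ⟨rfl, rfl⟩) <;>
      first | assumption | (apply Touch.symm; assumption)

/-- `K` contains a path from a neighbour of `a` to a neighbour of `b` with at least two vertices,
up to contraction. -/
def Leg (G : SimpleGraph V) (K : Set V) (a b : V) : Prop :=
  ∃ U W : Set V, U ⊆ K ∧ W ⊆ K ∧ Disjoint U W ∧ ConnOn G U ∧ ConnOn G W ∧ Touch G {a} U ∧
    Touch G U W ∧ Touch G W {b}

lemma minorOn_D3 {S K L M : Set V} {a b : V} (hab : a ≠ b) (ha : a ∈ S) (hb : b ∈ S)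
    (hS : K ∪ L ∪ M ⊆ S) (haK : a ∉ K ∪ L ∪ M) (hbK : b ∉ K ∪ L ∪ M) (dKL : Disjoint K L)
    (dKM : Disjoint K M) (dLM : Disjoint L M) (hK : Leg G K a b) (hL : Leg G L a b)
    (hM : Leg G M a b) : MinorOn D3 G S := by
  obtain ⟨U₁, W₁, hU₁, hW₁, d₁, cU₁, cW₁, e₁⟩ := hK
  obtain ⟨U₂, W₂, hU₂, hW₂, d₂, cU₂, cW₂, e₂⟩ := hL
  obtain ⟨U₃, W₃, hU₃, hW₃, d₃, cU₃, cW₃, e₃⟩ := hM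
  simp only [Set.union_subset_iff] at hS
  simp only [Set.mem_union, not_or] at haK hbK
  have hle : ∀ {A A' B B' : Set V}, Disjoint A B → A' ⊆ A → B' ⊆ B → Disjoint A' B' :=
    fun h h1 h2 => h.mono h1 h2
  have hsa : ∀ {A B : Set V} {x : V}, x ∉ A → B ⊆ A → Disjoint {x} B :=
    fun h h1 => Set.disjoint_singleton_left.2 fun h' => h (h1 h')
  refine MinorOn.fromRel ![{a}, {b}, U₁, W₁, U₂, W₂, U₃, W₃] ?_ ?_ ?_ ?_
  · intro w
    fin_cases w <;> first | assumption | exact ConnOn.singleton _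
  · intro w
    fin_cases w <;> first | exact Set.singleton_subset_iff.2 (by assumption) |
      exact hU₁.trans hS.1.1 | exact hW₁.trans hS.1.1 | exact hU₂.trans hS.1.2 |
      exact hW₂.trans hS.1.2 | exact hU₃.trans hS.2 | exact hW₃.trans hS.2
  · have key : ∀ i j : Fin 8, i < j → Disjoint (![{a}, {b}, U₁, W₁, U₂, W₂, U₃, W₃] i)
        (![{a}, {b}, U₁, W₁, U₂, W₂, U₃, W₃] j) := by
      intro i j hij
      fin_cases i <;> fin_cases j <;> first
        | exact absurd hij (by decide)
        | assumption
        | exact Set.disjoint_singleton.2 hab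
        | exact hle dKL (by assumption) (by assumption)
        | exact hle dKM (by assumption) (by assumption)
        | exact hle dLM (by assumption) (by assumption)
        | exact hsa haK.1.1 (by assumption)
        | exact hsa haK.1.2 (by assumption)
        | exact hsa haK.2 (by assumption)
        | exact hsa hbK.1.1 (by assumption)
        | exact hsa hbK.1.2 (by assumption)
        | exact hsa hbK.2 (by assumption)
    intro i j hij
    rcases lt_or_gt_of_ne hij with h | h
    · exact key i j h
    · exact (key j i h).symm
  · rintro w w' (⟨rfl, rfl⟩ | ⟨rfl, rfl⟩ | ⟨rfl, rfl⟩ | ⟨rfl, rfl⟩ | ⟨rfl, rfl⟩ | ⟨rfl, rfl⟩ |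
      ⟨rfl, rfl⟩ | ⟨rfl, rfl⟩ | ⟨rfl, rfl⟩)
    exacts [e₁.1, e₁.2.1, e₁.2.2, e₂.1, e₂.2.1, e₂.2.2, e₃.1, e₃.2.1, e₃.2.2]

end Minor

/-! ### 2-connected graphs without the three minors have path decompositions of width two -/

/-- `C` is a union of components of the graph induced by `S` with `a` and `b` deleted. -/
structure IsSide {V : Type} (G : SimpleGraph V) (S C : Set V) (a b : V) : Prop where
  sub : C ⊆ S
  left : a ∈ S
  right : b ∈ S
  ne : a ≠ b
  left_notMem : a ∉ C
  right_notMem : b ∉ C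
  closed : ∀ u ∈ C, ∀ v ∈ S, G.Adj u v → v ∈ C ∨ v = a ∨ v = b

/-- A connected set `T` attached to an `a`-`b` connection, all inside `D ∪ {a, b}`. -/
def Ear {V : Type} (G : SimpleGraph V) (D : Set V) (a b : V) : Prop :=
  ∃ A B T : Set V, A ⊆ insert a (insert b D) ∧ B ⊆ insert a (insert b D) ∧
    T ⊆ insert a (insert b D) ∧ a ∈ A ∧ b ∈ B ∧ ConnOn G A ∧ ConnOn G B ∧ ConnOn G T ∧
    Disjoint A B ∧ Disjoint T A ∧ Disjoint T B ∧ Touch G A B ∧ Touch G T A ∧ Touch G T B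

section Sides

variable {V : Type} {G : SimpleGraph V} {S C : Set V} {a b : V}

lemma IsSide.swap (h : IsSide G S C a b) : IsSide G S C b a :=
  ⟨h.sub, h.right, h.left, h.ne.symm, h.right_notMem, h.left_notMem,
    fun u hu v hv huv => (h.closed u hu v hv huv).imp_right Or.symm⟩

lemma IsSide.compl (h : IsSide G S C a b) : IsSide G S (S \ insert a (insert b C)) a b := by
  refine ⟨Set.sdiff_subset, h.left, h.right, h.ne, by simp, by simp, ?_⟩
  intro u hu v hv huv
  by_cases hvC : v ∈ C
  · have := h.closed v hvC u hu.1 huv.symm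
    grind
  · grind

lemma IsSide.of_closed (h : IsSide G S C a b) {K : Set V} (hK : K ⊆ C)
    (hcl : ∀ u ∈ K, ∀ v ∈ C, G.Adj u v → v ∈ K) : IsSide G S K a b :=
  ⟨hK.trans h.sub, h.left, h.right, h.ne, fun h' => h.left_notMem (hK h'),
    fun h' => h.right_notMem (hK h'), fun u hu v hv huv => by
      have := h.closed u (hK hu) v hv huv
      have := hcl u hu v
      tauto⟩

/-- If `v` is the only neighbour of `a` in `C`, then `v` may replace `a`. -/
lemma IsSide.advance (h : IsSide G S C a b) {v : V} (hv : v ∈ C)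
    (huniq : ∀ u ∈ C, G.Adj a u → u = v) : IsSide G S (C \ {v}) v b := by
  refine ⟨Set.sdiff_subset.trans h.sub, h.sub hv, h.right, fun e => h.right_notMem (e ▸ hv),
    by simp, fun h' => h.right_notMem h'.1, ?_⟩
  rintro u ⟨hu, huv⟩ w hw huw
  rcases h.closed u hu w hw huw with h' | rfl | rfl
  · by_cases e : w = v
    · exact .inr (.inl e)
    · exact .inl ⟨h', e⟩
  · exact absurd (huniq u hu huw.symm) huv
  · exact .inr (.inr rfl)

lemma IsSide.exists_adj_left (h : IsSide G S C a b) (h2 : TwoConnOn G S) (hne : C.Nonempty) :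
    ∃ u ∈ C, G.Adj a u := by
  obtain ⟨p, hp⟩ := hne
  obtain ⟨u, hu, huC, -, v, hv, hvC, hvb, huv⟩ := h2.cross h.right C
    ⟨p, h.sub hp, hp, fun e => h.right_notMem (e ▸ hp)⟩ ⟨a, h.left, h.left_notMem, h.ne⟩
  rcases h.closed u huC v hv huv with h' | rfl | rfl
  · exact absurd h' hvC
  · exact ⟨u, huC, huv.symm⟩
  · exact absurd rfl hvb

lemma ConnOn.subset_of_closed {Y U K : Set V} (hY : ConnOn G Y) (hYU : Y ⊆ U) {x : V} (hx : x ∈ Y)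
    (hxK : x ∈ K) (hK : ∀ u ∈ K, ∀ v ∈ U, G.Adj u v → v ∈ K) : Y ⊆ K := by
  by_contra hne
  obtain ⟨q, hq, hqK⟩ := Set.not_subset.1 hne
  obtain ⟨u, -, huK, v, hv, hvK, huv⟩ := hY.2 K ⟨x, hx, hxK⟩ ⟨q, hq, hqK⟩
  exact hvK (hK u huK v (hYU hv) huv)

lemma IsSide.leg (h : IsSide G S C a b) (h2 : TwoConnOn G S) (hC : ConnOn G C)
    (hnt : ∃ p ∈ C, ∃ q ∈ C, p ≠ q) : Leg G C a b := by
  obtain ⟨x, hx, y, hy, hxy, hax, hby⟩ : ∃ x ∈ C, ∃ y ∈ C, x ≠ y ∧ G.Adj a x ∧ G.Adj b y := by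
    by_contra! hcon
    obtain ⟨x, hx, hax⟩ := h.exists_adj_left h2 hC.1
    obtain ⟨y, hy, hby⟩ := h.swap.exists_adj_left h2 hC.1
    have hxb : ∀ u ∈ C, G.Adj b u → u = x := fun u hu hbu => by
      by_contra e
      exact hcon x hx u hu (Ne.symm e) hax hbu
    obtain rfl := hxb y hy hby
    have hxa : ∀ u ∈ C, G.Adj a u → u = y := fun u hu hau => by
      by_contra e
      exact hcon u hu y hy e hau hby
    obtain ⟨p, hp, hpy⟩ : ∃ p ∈ C, p ≠ y := by
      obtain ⟨p, hp, q, hq, hpq⟩ := hnt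
      by_cases e : p = y
      · exact ⟨q, hq, fun e' => hpq (e.trans e'.symm)⟩
      · exact ⟨p, hp, e⟩
    obtain ⟨u, -, huC, huy, v, hv, hvC, -, huv⟩ := h2.cross (h.sub hy) C ⟨p, h.sub hp, hp, hpy⟩
      ⟨a, h.left, h.left_notMem, fun e => h.left_notMem (e ▸ hy)⟩
    rcases h.closed u huC v hv huv with h' | rfl | rfl
    · exact hvC h'
    · exact huy (hxa u huC huv.symm)
    · exact huy (hxb u huC huv.symm)
  obtain ⟨U, hU, hxU, hUc, hUcl⟩ := exists_component (G := G) (U := C \ {y}) ⟨hx, hxy⟩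
  obtain ⟨u, -, huU, v, hv, hvU, huv⟩ := hC.2 U ⟨x, hx, hxU⟩ ⟨y, hy, fun h => (hU h).2 rfl⟩
  have hvy : v = y := by
    by_contra e
    exact hvU (hUcl u huU v ⟨hv, e⟩ huv)
  subst hvy
  exact ⟨U, {v}, fun _ h => (hU h).1, by simpa using hy,
    Set.disjoint_singleton_right.2 fun h => (hU h).2 rfl, hUc, .singleton v,
    ⟨a, rfl, x, hxU, hax⟩, ⟨u, huU, v, rfl, huv⟩, ⟨v, rfl, b, rfl, hby.symm⟩⟩

lemma IsSide.connOn_insert_right (h : IsSide G S C a b) (h2 : TwoConnOn G S) :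
    ConnOn G (insert b C) := by
  have key : ∀ K : Set V, b ∉ K → (∃ p ∈ insert b C, p ∈ K) →
      ∃ u ∈ insert b C, u ∈ K ∧ ∃ v ∈ insert b C, v ∉ K ∧ G.Adj u v := by
    rintro K hbK ⟨p, hp, hpK⟩
    have hpC : p ∈ C := hp.resolve_left fun e => hbK (e ▸ hpK)
    obtain ⟨u, hu, ⟨huK, huC⟩, hua, v, hv, hvK, hva, huv⟩ := h2.cross h.left (K ∩ C)
      ⟨p, h.sub hpC, ⟨hpK, hpC⟩, fun e => h.left_notMem (e ▸ hpC)⟩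
      ⟨b, h.right, fun h' => hbK h'.1, h.ne.symm⟩
    refine ⟨u, .inr huC, huK, v, ?_⟩
    rcases h.closed u huC v hv huv with h' | rfl | rfl
    · exact ⟨.inr h', fun h'' => hvK ⟨h'', h'⟩, huv⟩
    · exact absurd rfl hva
    · exact ⟨.inl rfl, hbK, huv⟩
  refine ⟨⟨b, .inl rfl⟩, ?_⟩
  rintro K hp ⟨q, hq, hqK⟩
  by_cases hbK : b ∈ K
  · obtain ⟨u, hu, huK, v, hv, hvK, huv⟩ := key Kᶜ (fun h => h hbK) ⟨q, hq, hqK⟩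
    exact ⟨v, hv, not_not.1 hvK, u, hu, huK, huv.symm⟩
  · exact key K hbK hp

lemma Ear.of_advance {v : V} (hv : v ∈ C) (ha : a ∉ C) (hab : a ≠ b) (hav : G.Adj a v)
    (h : Ear G (C \ {v}) v b) : Ear G C a b := by
  obtain ⟨A, B, T, hA, hB, hT, hvA, hbB, cA, cB, cT, dAB, dTA, dTB, tAB, tTA, tTB⟩ := h
  have hsub : insert v (insert b (C \ {v})) ⊆ insert a (insert b C) := by grind
  have hna : a ∉ insert v (insert b (C \ {v})) := by grind
  have hAA : A ⊆ insert a A := Set.subset_insert a A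
  refine ⟨insert a A, B, T, Set.insert_subset (by simp) (hA.trans hsub), hB.trans hsub,
    hT.trans hsub, by simp, hbB, cA.insert hvA hav, cB, cT, ?_, ?_, dTB,
    tAB.mono hAA le_rfl, tTA.mono le_rfl hAA, tTB⟩
  · exact Set.disjoint_insert_left.2 ⟨fun h => hna (hB h), dAB⟩
  · exact Set.disjoint_insert_right.2 ⟨fun h => hna (hT h), dTA⟩

/-- A path decomposition ending with `a, c` can be continued along a side without ears. -/
lemma PathRep.extend_side [Finite V] (h2 : TwoConnOn G S) : ∀ (n : ℕ) (D A : Set V) (a b c : V),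
    D.ncard = n → IsSide G S D a b → ¬ Ear G D a b → PathRep G A {a, c} 3 → A ⊆ S →
    Disjoint A (insert b D) → (∀ u ∈ A, G.Adj u b → u = a ∨ u = c) →
    PathRep G (A ∪ insert b D) {c, b} 3 := by
  intro n
  induction n with
  | zero =>
    intro D A a b c hn hD _ hA hAS hdis hAb
    obtain rfl := (Set.ncard_eq_zero (Set.toFinite D)).1 hn
    have : A ∪ insert b ∅ = insert b A := by ext; simp
    rw [this]
    exact hA.append ((Set.ncard_insert_le a {c}).trans (by simp))
      (fun h => Set.disjoint_left.1 hdis h (by simp))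
      (fun u hu hbu => by simpa using hAb u hu hbu.symm) (by grind)
  | succ n ih =>
    intro D A a b c hn hD hear hA hAS hdis hAb
    have hne : D.Nonempty := Set.nonempty_of_ncard_ne_zero (by omega)
    by_cases hu : ∃ v ∈ D, ∀ u ∈ insert b D, G.Adj a u → u = v
    · obtain ⟨v, hv, huniq⟩ := hu
      have hav : G.Adj a v := by
        obtain ⟨u, hu, hau⟩ := hD.exists_adj_left h2 hne
        rwa [← huniq u (.inr hu) hau]
      have hvA : v ∉ A := fun h => Set.disjoint_left.1 hdis h (.inr hv)
      have hvb : v ≠ b := fun e => hD.right_notMem (e ▸ hv)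
      have key := ih (D \ {v}) (insert v A) v b c
        (by rw [Set.ncard_sdiff_singleton_of_mem hv]; omega)
        (hD.advance hv fun u hu => huniq u (.inr hu))
        (fun h => hear (h.of_advance hv hD.left_notMem hD.ne hav))
        (hA.append ((Set.ncard_insert_le a {c}).trans (by simp)) hvA ?_ (by grind))
        (Set.insert_subset (hD.sub hv) hAS) ?_ ?_
      · convert key using 1
        grind
      · intro u hu hvu
        rcases hD.closed v hv u (hAS hu) hvu with h | rfl | rfl
        · exact absurd (.inr h) (Set.disjoint_left.1 hdis hu)
        · simp
        · exact absurd (.inl rfl) (Set.disjoint_left.1 hdis hu)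
      · rw [Set.disjoint_left] at hdis ⊢
        grind
      · rintro u (rfl | hu) hub
        · exact .inl rfl
        · rcases hAb u hu hub with rfl | rfl
          · exact absurd (huniq b (.inl rfl) hub) hvb.symm
          · exact .inr rfl
    · refine absurd ?_ hear
      push Not at hu
      obtain ⟨y, hy, K, hK, hyK, hbK, hKc, hay, ⟨x, hx, hax⟩, z, hz, hyz⟩ :=
        (hD.connOn_insert_right h2).exists_split (b := a) (c := b) (.inl rfl) (by
          rintro v (rfl | hv)
          · obtain ⟨u, hu, hau⟩ := hD.exists_adj_left h2 hne
            exact ⟨u, .inr hu, hau, fun e => hD.right_notMem (e ▸ hu)⟩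
          · exact hu v hv)
      have haQ : a ∉ insert b D := by
        rintro (h | h)
        exacts [hD.ne h, hD.left_notMem h]
      exact ⟨{a}, K, {y}, by simp, hK.trans (Set.subset_insert _ _),
        by simpa using Or.inr hy, rfl, hbK, .singleton a, hKc, .singleton y,
        Set.disjoint_singleton_left.2 fun h => haQ (hK h),
        Set.disjoint_singleton.2 fun e => haQ (e ▸ hy),
        Set.disjoint_singleton_left.2 hyK, ⟨a, rfl, x, hx, hax⟩, ⟨y, rfl, a, rfl, hay.symm⟩,
        ⟨y, rfl, z, hz, hyz⟩⟩

lemma PathRep.append_independent [Finite V] {A D : Set V} (hA : PathRep G A {a, b} 3)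
    (hdis : Disjoint A D) (hadj : ∀ u ∈ D, ∀ v ∈ A ∪ D, G.Adj u v → v = a ∨ v = b) :
    PathRep G (A ∪ D) {a, b} 3 := by
  induction D, Set.toFinite D using Set.Finite.induction_on with
  | empty => simpa using hA
  | @insert v D hv _ ih =>
    rw [Set.union_insert]
    rw [Set.disjoint_insert_right] at hdis
    refine (ih hdis.2 fun u hu w hw => hadj u (.inr hu) w (by grind)).append
      ((Set.ncard_insert_le a {b}).trans (by simp)) (by grind)
      (fun u hu hvu => ?_) (by simp)
    simpa using hadj v (.inl rfl) u (by grind) hvu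

/-- If the complement of a side contains a path from `a` to `b`, contract it onto `a`. -/
lemma IsSide.exists_bypass (h : IsSide G S C a b) (h2 : TwoConnOn G S)
    (hby : G.Adj a b ∨ ∃ d ∈ S, d ∉ C ∧ d ≠ a ∧ d ≠ b) :
    ∃ A ⊆ S, a ∈ A ∧ b ∉ A ∧ Disjoint A C ∧ ConnOn G A ∧ Touch G A {b} := by
  by_cases hab : G.Adj a b
  · exact ⟨{a}, by simpa using h.left, rfl, h.ne.symm, by simpa using h.left_notMem,
      .singleton a, a, rfl, b, rfl, hab⟩
  obtain ⟨d, hd, hdC, hda, hdb⟩ := hby.resolve_left hab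
  obtain ⟨K, hK, hdK, hKc, hcl⟩ := exists_component (G := G)
    (U := S \ insert a (insert b C)) (x := d) ⟨hd, by simp [hdC, hda, hdb]⟩
  have hside := h.compl.of_closed hK hcl
  obtain ⟨u, hu, hau⟩ := hside.exists_adj_left h2 hKc.1
  obtain ⟨v, hv, hbv⟩ := hside.swap.exists_adj_left h2 hKc.1
  refine ⟨insert a K, Set.insert_subset h.left hside.sub, .inl rfl, ?_, ?_, hKc.insert hu hau,
    v, .inr hv, b, rfl, hbv.symm⟩
  · rintro (e | h')
    exacts [h.ne e.symm, hside.right_notMem h']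
  · rw [Set.disjoint_left]
    rintro x (rfl | hx) hxC
    · exact h.left_notMem hxC
    · exact (hK hx).2 (.inr (.inr hxC))

end Sides

section MinorFree

variable {V : Type} {G : SimpleGraph V} {S C : Set V} {a b : V}

lemma IsSide.minorOn_K4 (h : IsSide G S C a b) (h2 : TwoConnOn G S) (hC : ConnOn G C)
    (hby : G.Adj a b ∨ ∃ d ∈ S, d ∉ C ∧ d ≠ a ∧ d ≠ b) {Y Z : Set V} (hY : Y ⊆ C) (hZ : Z ⊆ C)
    (hYZ : Disjoint Y Z) (cY : ConnOn G Y) (cZ : ConnOn G Z) (hYa : ∃ x ∈ Y, G.Adj a x)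
    (hYb : ∃ x ∈ Y, G.Adj b x) (hZa : ∃ x ∈ Z, G.Adj a x) (hZb : ∃ x ∈ Z, G.Adj b x) :
    MinorOn K4 G S := by
  obtain ⟨A, hAS, haA, hbA, hAC, cA, hAb⟩ := h.exists_bypass h2 hby
  obtain ⟨y, hy⟩ := cY.1
  have hYU : Y ⊆ C \ Z := fun x hx => ⟨hY hx, Set.disjoint_left.1 hYZ hx⟩
  obtain ⟨K, hKU, hyK, cK, hKcl⟩ := exists_component (G := G) (U := C \ Z) (hYU hy)
  have hYK : Y ⊆ K := cY.subset_of_closed hYU hy hyK hKcl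
  obtain ⟨z, hz⟩ := cZ.1
  have hKZ : Touch G K Z := by
    obtain ⟨u, hu, huK, v, hv, hvK, huv⟩ := hC.2 K ⟨y, hY hy, hyK⟩ ⟨z, hZ hz, fun h => (hKU h).2 hz⟩
    refine ⟨u, huK, v, ?_, huv⟩
    by_contra hvZ
    exact hvK (hKcl u huK v ⟨hv, hvZ⟩ huv)
  have hKC : K ⊆ C := fun x hx => (hKU hx).1
  have touch : ∀ {B T : Set V} {x : V}, x ∈ B → (∃ u ∈ T, G.Adj x u) → Touch G B T :=
    fun hx ⟨u, hu, h⟩ => ⟨_, hx, u, hu, h⟩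
  refine _root_.minorOn_K4 cA (.singleton b) cK cZ ?_ ?_ (hAC.mono_right hKC) (hAC.mono_right hZ)
    ?_ ?_ ?_ hAb ?_ (touch haA hZa) ?_ (touch rfl hZb) hKZ
  · have := h.right
    have := h.sub
    simp only [Set.union_subset_iff, Set.singleton_subset_iff]
    exact ⟨⟨⟨hAS, h.right⟩, hKC.trans h.sub⟩, hZ.trans h.sub⟩
  · exact Set.disjoint_singleton_right.2 hbA
  · exact Set.disjoint_singleton_left.2 fun h' => h.right_notMem (hKC h')
  · exact Set.disjoint_singleton_left.2 fun h' => h.right_notMem (hZ h')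
  · exact Set.disjoint_left.2 fun x hx => (hKU hx).2
  · obtain ⟨u, hu, hau⟩ := hYa
    exact ⟨a, haA, u, hYK hu, hau⟩
  · obtain ⟨u, hu, hau⟩ := hYb
    exact ⟨b, rfl, u, hYK hu, hau⟩

/-- A disconnected side together with the complementary side yields `D₃`, unless the whole graph
has a path decomposition of width two. -/
lemma IsSide.minorOn_D3_of_not_connOn [Finite V] (h : IsSide G S C a b) (h2 : TwoConnOn G S)
    (hno : ¬ PathRep G S ∅ 3) (hne : C.Nonempty) (hC : ¬ ConnOn G C)
    (hiso : ∀ v ∈ C, ∃ u ∈ C, G.Adj v u)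
    (ih : ∀ K ⊂ C, IsSide G S K a b → PathRep G (K ∪ {a, b}) {a, b} 3) : MinorOn D3 G S := by
  have hleg : ∀ {E K : Set V}, IsSide G S E a b → K ⊆ E → ConnOn G K →
      (∀ u ∈ K, ∀ v ∈ E, G.Adj u v → v ∈ K) → (∃ u ∈ K, ∃ v ∈ E, G.Adj u v) → Leg G K a b := by
    rintro E K hE hKE hK hcl ⟨u, hu, v, hv, huv⟩
    exact (hE.of_closed hKE hcl).leg h2 hK ⟨u, hu, v, hcl u hu v hv huv, huv.ne⟩
  obtain ⟨x, hx⟩ := hne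
  obtain ⟨K, hKC, hxK, cK, hKcl⟩ := exists_component (G := G) hx
  have hKne : K ≠ C := fun e => hC (e ▸ cK)
  obtain ⟨y, hy, hyK⟩ := Set.exists_of_ssubset (hKC.ssubset_of_ne hKne)
  have hcl2 : ∀ u ∈ C \ K, ∀ v ∈ C, G.Adj u v → v ∈ C \ K := fun u hu v hv huv =>
    ⟨hv, fun hvK => hu.2 (hKcl v hvK u hu.1 huv.symm)⟩
  have hs1 := h.of_closed hKC hKcl
  have hs2 := h.of_closed (K := C \ K) Set.sdiff_subset hcl2
  have hs3 := h.compl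
  obtain ⟨L, hLC, hyL, cL, hLcl⟩ := exists_component (G := G) (U := C \ K) ⟨hy, hyK⟩
  have hLcl' : ∀ u ∈ L, ∀ v ∈ C, G.Adj u v → v ∈ L := fun u hu v hv huv =>
    hLcl u hu v (hcl2 u (hLC hu) v hv huv) huv
  by_cases hD : ∃ u ∈ S \ insert a (insert b C), ∃ v ∈ S \ insert a (insert b C), G.Adj u v
  · obtain ⟨u, hu, v, hv, huv⟩ := hD
    obtain ⟨M, hM, huM, cM, hMcl⟩ := exists_component (G := G) hu
    have hLC' : L ⊆ C := fun z hz => (hLC hz).1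
    refine minorOn_D3 h.ne h.left h.right ?_ ?_ ?_ ?_ ?_ ?_
      (hleg h hKC cK hKcl ?_) (hleg h hLC' cL hLcl' ?_) (hleg hs3 hM cM hMcl ⟨u, huM, v, hv, huv⟩)
    · exact Set.union_subset (Set.union_subset hs1.sub (hLC'.trans h.sub)) (hM.trans hs3.sub)
    · have := h.left_notMem
      rintro ((h' | h') | h')
      exacts [this (hKC h'), this (hLC' h'), (hM h').2 (by simp)]
    · have := h.right_notMem
      rintro ((h' | h') | h')
      exacts [this (hKC h'), this (hLC' h'), (hM h').2 (by simp)]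
    · exact Set.disjoint_right.2 fun z hz => (hLC hz).2
    · exact Set.disjoint_right.2 fun z hz hzK => (hM hz).2 (.inr (.inr (hKC hzK)))
    · exact Set.disjoint_right.2 fun z hz hzL => (hM hz).2 (.inr (.inr (hLC' hzL)))
    · obtain ⟨u, hu, hxu⟩ := hiso x hx
      exact ⟨x, hxK, u, hu, hxu⟩
    · obtain ⟨u, hu, hyu⟩ := hiso y hy
      exact ⟨y, hyL, u, hu, hyu⟩
  · push Not at hD
    refine absurd ?_ hno
    have p1 := (ih K (hKC.ssubset_of_ne hKne) hs1).append_independent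
      (D := S \ insert a (insert b C)) (by rw [Set.disjoint_left]; grind) (by
        intro u hu v hv huv
        have hvS : v ∈ S := by
          rcases hv with (h' | rfl | rfl) | h'
          exacts [hs1.sub h', h.left, h.right, h'.1]
        exact (hs3.closed u hu v hvS huv).resolve_left fun h' => hD u hu v h' huv)
    have p2 := ih (C \ K) ⟨Set.sdiff_subset, fun h' => (h' hx).2 hxK⟩ hs2
    have p3 := p1.concat p2 (by simp) (by simp) (by simp) (by simp) (by grind) (by
      intro u hu v hv huv
      rcases hv with h' | rfl | rfl
      · have := hs2.closed v h' u ?_ huv.symm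
        · left; grind
        · rcases hu with (h' | rfl | rfl) | h'
          exacts [hs1.sub h', h.left, h.right, h'.1]
      · simp
      · simp)
    convert p3 using 1
    have := h.sub
    have := h.left
    have := h.right
    clear hleg hKcl hcl2 hLcl hLcl' hD ih hiso
    grind

/-- A connected side with a cut vertex `c` separating the neighbours of `a` and `b` yields `S₃`,
unless the whole graph has a path decomposition of width two. -/
lemma IsSide.minorOn_S3_of_cutvertex [Finite V] (h : IsSide G S C a b) (h2 : TwoConnOn G S)
    (hno : ¬ PathRep G S ∅ 3) {c : V} (hc : c ∈ C)
    (ha : ∀ v ∈ C, ∃ u ∈ C, G.Adj a u ∧ u ≠ v) (hb : ∀ v ∈ C, ∃ u ∈ C, G.Adj b u ∧ u ≠ v)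
    (hcut : ∀ P ⊆ C \ {c}, ConnOn G P → (∃ x ∈ P, G.Adj a x) → ∀ y ∈ P, ¬ G.Adj b y)
    (ih : ∀ K ⊂ C, ∀ x y, IsSide G S K x y → (∃ d ∈ S, d ∉ K ∧ d ≠ x ∧ d ≠ y) →
      PathRep G (K ∪ {x, y}) {x, y} 3) : MinorOn S3 G S := by
  have hca : c ≠ a := fun e => h.left_notMem (e ▸ hc)
  have hcb : c ≠ b := fun e => h.right_notMem (e ▸ hc)
  let L : Set V := {x | ∃ P ⊆ C \ {c}, ConnOn G P ∧ x ∈ P ∧ ∃ y ∈ P, G.Adj a y}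
  let R : Set V := (C \ {c}) \ L
  have hLsub : L ⊆ C \ {c} := by
    rintro x ⟨P, hP, -, hx, -⟩
    exact hP hx
  have hRsub : R ⊆ C \ {c} := Set.sdiff_subset
  have hLext : ∀ u ∈ L, ∀ v ∈ C \ {c}, G.Adj u v → v ∈ L := by
    rintro u ⟨P, hP, cP, hu, y, hy, hay⟩ v hv huv
    exact ⟨insert v P, Set.insert_subset hv hP, cP.insert hu huv.symm, .inl rfl, y, .inr hy, hay⟩
  have hLa : ∀ u ∈ C \ {c}, G.Adj a u → u ∈ L := fun u hu hau =>
    ⟨{u}, by simpa using hu, .singleton u, rfl, u, rfl, hau⟩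
  have hLb : ∀ u ∈ L, ¬ G.Adj b u := by
    rintro u ⟨P, hP, cP, hu, hy⟩
    exact hcut P hP cP hy u hu
  have sL : IsSide G S L a c := by
    refine ⟨fun x hx => h.sub (hLsub hx).1, h.left, h.sub hc, hca.symm,
      fun h' => h.left_notMem (hLsub h').1, fun h' => (hLsub h').2 rfl, ?_⟩
    intro u hu v hv huv
    rcases h.closed u (hLsub hu).1 v hv huv with h' | h' | rfl
    · by_cases e : v = c
      · exact .inr (.inr e)
      · exact .inl (hLext u hu v ⟨h', e⟩ huv)
    · exact .inr (.inl h')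
    · exact absurd huv.symm (hLb u hu)
  have sR : IsSide G S R c b := by
    refine ⟨fun x hx => h.sub (hRsub hx).1, h.sub hc, h.right, hcb,
      fun h' => (hRsub h').2 rfl, fun h' => h.right_notMem (hRsub h').1, ?_⟩
    intro u hu v hv huv
    rcases h.closed u (hRsub hu).1 v hv huv with h' | rfl | h'
    · by_cases e : v = c
      · exact .inr (.inl e)
      · exact .inl ⟨⟨h', e⟩, fun hvL => hu.2 (hLext v hvL u hu.1 huv.symm)⟩
    · exact absurd (hLa u hu.1 huv.symm) hu.2
    · exact .inr (.inr h')
  have hcL : c ∉ L := sL.right_notMem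
  have hcR : c ∉ R := sR.left_notMem
  have hLC : L ⊆ C := fun x hx => (hLsub hx).1
  have hRC : R ⊆ C := fun x hx => (hRsub hx).1
  have pL := ih L ⟨hLC, fun h' => hcL (h' hc)⟩ a c sL
    ⟨b, h.right, fun h' => h.right_notMem (hLC h'), h.ne.symm, hcb.symm⟩
  have pR := ih R ⟨hRC, fun h' => hcR (h' hc)⟩ c b sR
    ⟨a, h.left, fun h' => h.left_notMem (hRC h'), hca.symm, h.ne⟩
  have hCLR : ∀ u ∈ C, u = c ∨ u ∈ L ∨ u ∈ R := by
    intro u hu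
    by_cases e : u = c
    · exact .inl e
    · by_cases hL : u ∈ L
      exacts [.inr (.inl hL), .inr (.inr ⟨⟨hu, e⟩, hL⟩)]
  by_cases hear : Ear G (S \ insert a (insert b C)) a b
  · obtain ⟨y₁, hy₁, K₁, hK₁, hyK₁, hcK₁, cK₁, hay₁, ⟨x₁, hx₁, hax₁⟩, z₁, hz₁, hyz₁⟩ :=
      (sL.connOn_insert_right h2).exists_split (b := a) (c := c) (.inl rfl) (by
        intro v hv
        obtain ⟨u, hu, hau, huv⟩ := ha v (by rcases hv with rfl | hv; exacts [hc, hLC hv])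
        refine ⟨u, ?_, hau, huv⟩
        by_cases e : u = c
        exacts [.inl e, .inr (hLa u ⟨hu, e⟩ hau)])
    obtain ⟨y₂, hy₂, K₂, hK₂, hyK₂, hcK₂, cK₂, hby₂, ⟨x₂, hx₂, hbx₂⟩, z₂, hz₂, hyz₂⟩ :=
      (sR.swap.connOn_insert_right h2).exists_split (b := b) (c := c) (.inl rfl) (by
        intro v hv
        obtain ⟨u, hu, hbu, huv⟩ := hb v (by rcases hv with rfl | hv; exacts [hc, hRC hv])
        refine ⟨u, ?_, hbu, huv⟩
        rcases hCLR u hu with e | hL | hR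
        exacts [.inl e, absurd hbu (hLb u hL), .inr hR])
    have hy₁L : y₁ ∈ L := hy₁.resolve_left fun e => hyK₁ (e ▸ hcK₁)
    have hy₂R : y₂ ∈ R := hy₂.resolve_left fun e => hyK₂ (e ▸ hcK₂)
    have hLR : ∀ x ∈ L, x ∉ R := fun x hx hxR => hxR.2 hx
    obtain ⟨A, B, T, hA, hB, hT, haA, hbB, cA, cB, cT, dAB, dTA, dTB, tAB, tTA, tTB⟩ := hear
    have houter : ∀ {E : Set V}, E ⊆ insert a (insert b (S \ insert a (insert b C))) →
        E ⊆ S ∧ ∀ x ∈ E, x ∉ C := by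
      intro E hE
      refine ⟨fun x hx => ?_, fun x hx hxC => ?_⟩
      · rcases hE hx with rfl | rfl | h'
        exacts [h.left, h.right, h'.1]
      · rcases hE hx with rfl | rfl | h'
        exacts [h.left_notMem hxC, h.right_notMem hxC, h'.2 (.inr (.inr hxC))]
    have hK₁C : K₁ ⊆ C := hK₁.trans (Set.insert_subset hc hLC)
    have hK₂C : K₂ ⊆ C := hK₂.trans (Set.insert_subset hc hRC)
    have hKC : K₁ ∪ K₂ ⊆ C := Set.union_subset hK₁C hK₂C
    have dC : ∀ {E F : Set V}, E ⊆ insert a (insert b (S \ insert a (insert b C))) → F ⊆ C →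
        Disjoint E F := fun hE hF => Set.disjoint_left.2 fun x hx hxF => (houter hE).2 x hx (hF hxF)
    have hy₁C : {y₁} ⊆ C := by simpa using hLC hy₁L
    have hy₂C : {y₂} ⊆ C := by simpa using hRC hy₂R
    refine minorOn_S3 cA (cK₁.union cK₂ hcK₁ hcK₂ (.inl rfl)) cB (.singleton y₁) (.singleton y₂) cT
      ?_ (dC hA hKC) dAB (dC hB hKC).symm ?_ ?_ ?_ ?_ (dC hT hy₁C).symm (dC hT hy₂C).symm
      ⟨a, haA, x₁, .inl hx₁, hax₁⟩ tAB ⟨x₂, .inr hx₂, b, hbB, hbx₂.symm⟩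
      ⟨y₁, rfl, a, haA, hay₁.symm⟩ ⟨y₁, rfl, z₁, .inl hz₁, hyz₁⟩
      ⟨y₂, rfl, z₂, .inr hz₂, hyz₂⟩ ⟨y₂, rfl, b, hbB, hby₂.symm⟩ tTA tTB
    · simp only [Set.union_subset_iff]
      have := h.sub
      exact ⟨⟨⟨⟨⟨(houter hA).1, hK₁C.trans this, hK₂C.trans this⟩, (houter hB).1⟩,
        hy₁C.trans this⟩, hy₂C.trans this⟩, (houter hT).1⟩
    · simp only [Set.disjoint_union_right]
      refine ⟨⟨(dC hA hy₁C).symm, Set.disjoint_singleton_left.2 hyK₁,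
        Set.disjoint_singleton_left.2 fun h' => ?_⟩, (dC hB hy₁C).symm⟩
      rcases hK₂ h' with e | h''
      exacts [hcL (e ▸ hy₁L), hLR y₁ hy₁L h'']
    · simp only [Set.disjoint_union_right]
      refine ⟨⟨(dC hA hy₂C).symm, Set.disjoint_singleton_left.2 fun h' => ?_,
        Set.disjoint_singleton_left.2 hyK₂⟩, (dC hB hy₂C).symm⟩
      rcases hK₁ h' with e | h''
      exacts [hcR (e ▸ hy₂R), hLR y₂ h'' hy₂R]
    · simp only [Set.disjoint_union_right]
      exact ⟨⟨dTA, dC hT hK₁C, dC hT hK₂C⟩, dTB⟩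
    · exact Set.disjoint_singleton.2 fun e => hLR y₁ hy₁L (e ▸ hy₂R)
  · refine absurd ?_ hno
    have hbL : b ∉ L := fun h' => h.right_notMem (hLC h')
    have haR : a ∉ R := fun h' => h.left_notMem (hRC h')
    have hAS : L ∪ {a, c} ⊆ S :=
      Set.union_subset sL.sub (Set.insert_subset h.left (by simpa using h.sub hc))
    have pD := PathRep.extend_side h2 _ _ (L ∪ {a, c}) a b c rfl h.compl hear pL hAS (by
        rw [Set.disjoint_left]
        have := h.ne
        grind) (by
        rintro u (hu | hu) hub
        · exact absurd hub.symm (hLb u hu)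
        · simpa using hu)
    have p := pD.concat pR (by simp) (by simp) (by simp) (by simp) (by
        intro x hx hxR
        have := h.ne
        grind) (by
        intro u hu v hv huv
        rcases hv with h' | rfl | rfl
        · left
          have := sR.closed v h' u ?_ huv.symm
          · grind
          · rcases hu with h' | rfl | h'
            exacts [hAS h', h.right, h'.1]
        · simp
        · simp)
    convert p using 1
    have := h.sub
    have := h.left
    have := h.right
    grind

lemma IsSide.pathRep [Finite V] (h2 : TwoConnOn G S) (hno : ¬ PathRep G S ∅ 3) (hK4 : ¬ MinorOn K4 G S)
    (hD3 : ¬ MinorOn D3 G S) (hS3 : ¬ MinorOn S3 G S) : ∀ (n : ℕ) (C : Set V) (a b : V),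
    C.ncard = n → IsSide G S C a b → (G.Adj a b ∨ ∃ d ∈ S, d ∉ C ∧ d ≠ a ∧ d ≠ b) →
    PathRep G (C ∪ {a, b}) {a, b} 3 := by
  intro n
  induction n using Nat.strong_induction_on with
  | _ n ih =>
  rintro C a b rfl h hby
  have ih' : ∀ K ⊂ C, ∀ x y, IsSide G S K x y → (∃ d ∈ S, d ∉ K ∧ d ≠ x ∧ d ≠ y) →
      PathRep G (K ∪ {x, y}) {x, y} 3 := fun K hK x y hs hd =>
    ih K.ncard (Set.ncard_lt_ncard hK) K x y rfl hs (.inr hd)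
  rcases C.eq_empty_or_nonempty with rfl | hne
  · simpa using pathRep_pair a b
  have hmem : ∀ K ⊂ C, ∃ d ∈ S, d ∉ K ∧ d ≠ a ∧ d ≠ b := fun K hK => by
    obtain ⟨d, hd, hdK⟩ := Set.exists_of_ssubset hK
    exact ⟨d, h.sub hd, hdK, fun e => h.left_notMem (e ▸ hd), fun e => h.right_notMem (e ▸ hd)⟩
  by_cases hiso : ∀ v ∈ C, ∃ u ∈ C, G.Adj v u
  swap
  · push Not at hiso
    obtain ⟨v, hv, hiso⟩ := hiso
    have hss : C \ {v} ⊂ C := ⟨Set.sdiff_subset, fun h' => (h' hv).2 rfl⟩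
    have p := ih' _ hss a b (h.of_closed hss.1 fun u hu w hw huw =>
      ⟨hw, fun e => hiso u hu.1 (e ▸ huw.symm)⟩) (hmem _ hss)
    have hva : v ≠ a := fun e => h.left_notMem (e ▸ hv)
    have hvb : v ≠ b := fun e => h.right_notMem (e ▸ hv)
    have p := p.append ((Set.ncard_insert_le a {b}).trans (by simp)) (v := v) (by simp [hva, hvb])
      (by
        rintro u (hu | hu) hvu
        · exact absurd hvu (hiso u hu.1)
        · exact hu) (Set.subset_insert _ _)
    convert p using 1
    grind
  have hadv : ∀ x y, IsSide G S C x y → (∃ v ∈ C, ∀ u ∈ C, G.Adj x u → u = v) →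
      PathRep G (C ∪ {x, y}) {x, y} 3 := by
    rintro x y hs ⟨v, hv, huniq⟩
    have hss : C \ {v} ⊂ C := ⟨Set.sdiff_subset, fun h' => (h' hv).2 rfl⟩
    have hvx : v ≠ x := fun e => hs.left_notMem (e ▸ hv)
    have p := ih' _ hss v y (hs.advance hv huniq)
      ⟨x, hs.left, fun h' => hs.left_notMem h'.1, hvx.symm, hs.ne⟩
    have := hs.left_notMem
    have := hs.ne
    have p := p.append ((Set.ncard_insert_le v {y}).trans (by simp)) (v := x) (by grind)
      (by
        rintro u (hu | hu) hvu
        · exact .inl (huniq u hu.1 hvu)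
        · exact hu) (Y := {x, y}) (by grind)
    convert p using 1
    grind
  by_cases ha : ∃ v ∈ C, ∀ u ∈ C, G.Adj a u → u = v
  · exact hadv a b h ha
  by_cases hb : ∃ v ∈ C, ∀ u ∈ C, G.Adj b u → u = v
  · simpa only [Set.pair_comm] using hadv b a h.swap hb
  by_cases hC : ConnOn G C
  swap
  · exact absurd (h.minorOn_D3_of_not_connOn h2 hno hne hC hiso fun K hK hs =>
      ih' K hK a b hs (hmem K hK)) hD3
  push Not at ha hb
  by_cases hcut : ∀ c ∈ C, ∃ P ⊆ C \ {c}, ConnOn G P ∧ (∃ x ∈ P, x ∈ {v | G.Adj a v}) ∧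
      ∃ y ∈ P, y ∈ {v | G.Adj b v}
  · obtain ⟨Y, hY, Z, hZ, hYZ, cY, cZ, hYa, hYb, hZa, hZb⟩ :=
      exists_two_disjoint_connOn {v | G.Adj b v} _ C {v | G.Adj a v} rfl hne hcut
    exact absurd (h.minorOn_K4 h2 hC hby hY hZ hYZ cY cZ hYa hYb hZa hZb) hK4
  · push Not at hcut
    obtain ⟨c, hc, hcut⟩ := hcut
    refine absurd (h.minorOn_S3_of_cutvertex h2 hno hc ha hb (fun P hP cP hPa y hy hby => ?_) ih') hS3
    exact hcut P hP cP hPa y hy hby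

lemma TwoConnOn.pathRep [Finite V] (h2 : TwoConnOn G S) (hK4 : ¬ MinorOn K4 G S) (hD3 : ¬ MinorOn D3 G S)
    (hS3 : ¬ MinorOn S3 G S) : PathRep G S ∅ 3 := by
  by_contra hno
  obtain ⟨a, ha, q, hq, haq⟩ := (Set.one_lt_ncard (Set.toFinite S)).1 (by have := h2.1; omega)
  obtain ⟨u, hu, rfl, b, hb, hba, huv⟩ := h2.connOn.2 {a} ⟨a, ha, rfl⟩ ⟨q, hq, Ne.symm haq⟩
  refine hno ?_
  have := IsSide.pathRep h2 hno hK4 hD3 hS3 _ (S \ {u, b}) u b rfl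
    ⟨Set.sdiff_subset, ha, hb, huv.ne, by simp, by simp, fun x _ y hy _ => by grind⟩ (.inl huv)
  convert this.mono_last (Set.empty_subset _) using 1
  grind

end MinorFree

/-! ### The three minors have pathwidth larger than two -/

section IntervalModel

variable {W V : Type} {H : SimpleGraph W} {G : SimpleGraph V} {S : Set V}

/-- A minor of a graph of small pathwidth has an interval representation of the same width. -/
lemma MinorOn.exists_intervals [Finite V] (hm : MinorOn H G S) (hp : PathRep G S ∅ 3) :
    ∃ l r : W → ℤ, (∀ w, l w ≤ r w) ∧ (∀ w w', H.Adj w w' → l w ≤ r w') ∧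
      ∀ (t : ℤ) (F : Finset W), 4 ≤ F.card → ∃ w ∈ F, t < l w ∨ r w < t := by
  obtain ⟨f, hc, hS, hd, he⟩ := hm
  obtain ⟨l, r, N, h1, -, h3, h4⟩ := hp
  choose p hp hmin using fun w => Set.exists_min_image (f w) l (Set.toFinite _) (hc w).1
  choose q hq hmax using fun w => Set.exists_max_image (f w) r (Set.toFinite _) (hc w).1
  refine ⟨fun w => l (p w), fun w => r (q w), fun w => ?_, fun w w' hww => ?_, fun t F hF => ?_⟩
  · exact ((h1 _ (hS w (hp w))).1).trans (hmax w _ (hp w))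
  · obtain ⟨u, hu, v, hv, huv⟩ := he hww
    exact (hmin w u hu).trans ((h3 u (hS _ hu) v (hS _ hv) huv).trans (hmax w' v hv))
  · by_contra! hcon
    have hex : ∀ w, ∃ v ∈ f w, w ∈ F → l v ≤ t ∧ t ≤ r v := by
      intro w
      by_cases hw : w ∈ F
      swap
      · exact ⟨p w, hp w, fun h => absurd h hw⟩
      by_contra! h
      obtain ⟨h5, h6⟩ := hcon w hw
      replace h : ∀ v ∈ f w, l v ≤ t → r v < t := fun v hv hl => by
        by_contra h7
        exact absurd (h v hv) (by grind)
      obtain ⟨u, hu, huK, v, hv, hvK, huv⟩ := (hc w).2 {v | r v < t}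
        ⟨p w, hp w, h _ (hp w) h5⟩ ⟨q w, hq w, not_lt.2 h6⟩
      have h7 := h3 v (hS w hv) u (hS w hu) huv.symm
      exact hvK (h v hv (h7.trans (le_of_lt huK)))
    have : (F : Set W).ncard ≤ {v | v ∈ S ∧ l v ≤ t ∧ t ≤ r v}.ncard := by
      choose g hg hgt using hex
      refine Set.ncard_le_ncard_of_injOn g (fun w hw => ⟨hS w (hg w), hgt w hw⟩) ?_
      intro w hw w' hw' hww
      by_contra hne
      exact Set.disjoint_left.1 (hd hne) (hg w) (hww ▸ hg w')
    rw [Set.ncard_coe_finset] at this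
    have := h4 t
    omega

lemma K4_not_intervals {l r : Fin 4 → ℤ} (hlr : ∀ w, l w ≤ r w)
    (hadj : ∀ w w', K4.Adj w w' → l w ≤ r w')
    (hbag : ∀ (t : ℤ) (F : Finset (Fin 4)), 4 ≤ F.card → ∃ w ∈ F, t < l w ∨ r w < t) : False := by
  obtain ⟨m, -, hm⟩ := Finset.exists_max_image Finset.univ l ⟨0, Finset.mem_univ _⟩
  obtain ⟨w, -, hw⟩ := hbag (l m) Finset.univ (by simp)
  have h1 := hm w (Finset.mem_univ _)
  have h2 : l m ≤ r w := by
    by_cases e : m = w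
    · exact e ▸ hlr m
    · exact hadj m w e
  omega

lemma S3_not_intervals {l r : Fin 6 → ℤ} (hlr : ∀ w, l w ≤ r w)
    (hadj : ∀ w w', S3.Adj w w' → l w ≤ r w')
    (hbag : ∀ (t : ℤ) (F : Finset (Fin 6)), 4 ≤ F.card → ∃ w ∈ F, t < l w ∨ r w < t) : False := by
  have hadj' : ∀ w w', w ≠ w' → S3.Adj w w' → l w ≤ r w' ∧ l w' ≤ r w :=
    fun w w' _ h => ⟨hadj w w' h, hadj w' w h.symm⟩
  have a01 := hadj' 0 1 (by decide) ⟨by decide, by decide⟩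
  have a12 := hadj' 1 2 (by decide) ⟨by decide, by decide⟩
  have a23 := hadj' 2 3 (by decide) ⟨by decide, by decide⟩
  have a34 := hadj' 3 4 (by decide) ⟨by decide, by decide⟩
  have a45 := hadj' 4 5 (by decide) ⟨by decide, by decide⟩
  have a50 := hadj' 5 0 (by decide) ⟨by decide, by decide⟩
  have a13 := hadj' 1 3 (by decide) ⟨by decide, by decide⟩
  have a35 := hadj' 3 5 (by decide) ⟨by decide, by decide⟩
  have a51 := hadj' 5 1 (by decide) ⟨by decide, by decide⟩
  have b := fun e => hbag (max (max (l 1) (l 3)) (max (l 5) (l e))) {1, 3, 5, e}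
  have b0 := b 0 (by decide)
  have b2 := b 2 (by decide)
  have b4 := b 4 (by decide)
  simp only [Finset.mem_insert, Finset.mem_singleton, exists_eq_or_imp, exists_eq_left] at b0 b2 b4
  have h0 := hlr 0; have h1 := hlr 1; have h2 := hlr 2
  have h3 := hlr 3; have h4 := hlr 4; have h5 := hlr 5
  have b0 : r 0 < max (max (l 1) (l 3)) (l 5) ∨ min (min (r 1) (r 3)) (r 5) < l 0 := by omega
  have b2 : r 2 < max (max (l 1) (l 3)) (l 5) ∨ min (min (r 1) (r 3)) (r 5) < l 2 := by omega
  have b4 : r 4 < max (max (l 1) (l 3)) (l 5) ∨ min (min (r 1) (r 3)) (r 5) < l 4 := by omega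
  omega

lemma D3_not_intervals {l r : Fin 8 → ℤ} (hlr : ∀ w, l w ≤ r w)
    (hadj : ∀ w w', D3.Adj w w' → l w ≤ r w')
    (hbag : ∀ (t : ℤ) (F : Finset (Fin 8)), 4 ≤ F.card → ∃ w ∈ F, t < l w ∨ r w < t) : False := by
  have hadj' : ∀ w w', D3.Adj w w' → l w ≤ r w' ∧ l w' ≤ r w :=
    fun w w' h => ⟨hadj w w' h, hadj w' w h.symm⟩
  -- the union of the two intervals of a leg is an interval meeting the intervals of `0` and `1`
  have leg : ∀ x y, D3.Adj 0 x → D3.Adj x y → D3.Adj y 1 → ∃ m M, m ≤ M ∧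
      m ≤ r 0 ∧ l 0 ≤ M ∧ m ≤ r 1 ∧ l 1 ≤ M ∧ (m = l x ∨ m = l y) ∧ (M = r x ∨ M = r y) ∧
      m ≤ l x ∧ m ≤ l y ∧ r x ≤ M ∧ r y ≤ M ∧
      ∀ t, m ≤ t → t ≤ M → ∃ w, (w = x ∨ w = y) ∧ l w ≤ t ∧ t ≤ r w := by
    intro x y h0 h1 h2
    have := hadj' _ _ h0; have := hadj' _ _ h1; have := hadj' _ _ h2
    have := hlr x; have := hlr y
    refine ⟨min (l x) (l y), max (r x) (r y), by omega, by omega, by omega, by omega, by omega,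
      by omega, by omega, by omega, by omega, by omega, by omega, fun t h3 h4 => ?_⟩
    by_cases h5 : l x ≤ t ∧ t ≤ r x
    · exact ⟨x, .inl rfl, h5⟩
    · exact ⟨y, .inr rfl, by omega, by omega⟩
  obtain ⟨m₁, M₁, h₁, p₁, q₁, s₁, u₁, -, -, x₁, y₁, z₁, w₁, c₁⟩ :=
    leg 2 3 ⟨by decide, by decide⟩ ⟨by decide, by decide⟩ ⟨by decide, by decide⟩
  obtain ⟨m₂, M₂, h₂, p₂, q₂, s₂, u₂, -, -, x₂, y₂, z₂, w₂, c₂⟩ :=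
    leg 4 5 ⟨by decide, by decide⟩ ⟨by decide, by decide⟩ ⟨by decide, by decide⟩
  obtain ⟨m₃, M₃, h₃, p₃, q₃, s₃, u₃, -, -, x₃, y₃, z₃, w₃, c₃⟩ :=
    leg 6 7 ⟨by decide, by decide⟩ ⟨by decide, by decide⟩ ⟨by decide, by decide⟩
  have four : ∀ (t : ℤ) (i j k n : Fin 8), ({i, j, k, n} : Finset (Fin 8)).card = 4 →
      (l i ≤ t ∧ t ≤ r i) → (l j ≤ t ∧ t ≤ r j) → (l k ≤ t ∧ t ≤ r k) → (l n ≤ t ∧ t ≤ r n) →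
      False := by
    intro t i j k n hcard hi hj hk hn
    obtain ⟨w, hw, h⟩ := hbag t _ hcard.ge
    simp only [Finset.mem_insert, Finset.mem_singleton] at hw
    rcases hw with rfl | rfl | rfl | rfl <;> omega
  have all : ∀ t : ℤ, m₁ ≤ t → t ≤ M₁ → m₂ ≤ t → t ≤ M₂ → m₃ ≤ t → t ≤ M₃ →
      (l 0 ≤ t ∧ t ≤ r 0) ∨ (l 1 ≤ t ∧ t ≤ r 1) → False := by
    intro t a1 a2 a3 a4 a5 a6 h
    obtain ⟨i, hi, hi'⟩ := c₁ t a1 a2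
    obtain ⟨j, hj, hj'⟩ := c₂ t a3 a4
    obtain ⟨k, hk, hk'⟩ := c₃ t a5 a6
    rcases h with h | h
    · refine four t 0 i j k ?_ h hi' hj' hk'
      rcases hi with rfl | rfl <;> rcases hj with rfl | rfl <;> rcases hk with rfl | rfl <;> rfl
    · refine four t 1 i j k ?_ h hi' hj' hk'
      rcases hi with rfl | rfl <;> rcases hj with rfl | rfl <;> rcases hk with rfl | rfl <;> rfl
  have n0 := hlr 0
  have n1 := hlr 1
  by_cases hA : r 0 < l 1
  · exact all (r 0) (by omega) (by omega) (by omega) (by omega) (by omega) (by omega)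
      (.inl ⟨n0, le_rfl⟩)
  by_cases hB : r 1 < l 0
  · exact all (r 1) (by omega) (by omega) (by omega) (by omega) (by omega) (by omega)
      (.inr ⟨n1, le_rfl⟩)
  have d₁₂ : M₁ < m₂ ∨ M₂ < m₁ := by
    by_contra hcon
    obtain ⟨i, hi, hi'⟩ := c₁ (max (max (l 0) (l 1)) (max m₁ m₂)) (by omega) (by omega)
    obtain ⟨j, hj, hj'⟩ := c₂ (max (max (l 0) (l 1)) (max m₁ m₂)) (by omega) (by omega)
    refine four _ 0 1 i j ?_ (by omega) (by omega) hi' hj'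
    rcases hi with rfl | rfl <;> rcases hj with rfl | rfl <;> rfl
  have d₁₃ : M₁ < m₃ ∨ M₃ < m₁ := by
    by_contra hcon
    obtain ⟨i, hi, hi'⟩ := c₁ (max (max (l 0) (l 1)) (max m₁ m₃)) (by omega) (by omega)
    obtain ⟨j, hj, hj'⟩ := c₃ (max (max (l 0) (l 1)) (max m₁ m₃)) (by omega) (by omega)
    refine four _ 0 1 i j ?_ (by omega) (by omega) hi' hj'
    rcases hi with rfl | rfl <;> rcases hj with rfl | rfl <;> rfl
  have d₂₃ : M₂ < m₃ ∨ M₃ < m₂ := by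
    by_contra hcon
    obtain ⟨i, hi, hi'⟩ := c₂ (max (max (l 0) (l 1)) (max m₂ m₃)) (by omega) (by omega)
    obtain ⟨j, hj, hj'⟩ := c₃ (max (max (l 0) (l 1)) (max m₂ m₃)) (by omega) (by omega)
    refine four _ 0 1 i j ?_ (by omega) (by omega) hi' hj'
    rcases hi with rfl | rfl <;> rcases hj with rfl | rfl <;> rfl
  have a23 := hadj' 2 3 ⟨by decide, by decide⟩
  have a45 := hadj' 4 5 ⟨by decide, by decide⟩
  have a67 := hadj' 6 7 ⟨by decide, by decide⟩
  have := hlr 2; have := hlr 3; have := hlr 4; have := hlr 5; have := hlr 6; have := hlr 7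
  -- the middle leg lies inside the intersection of the intervals of `0` and `1`
  have mid : ∀ (x y : Fin 8) (m M : ℤ), ({0, 1, x, y} : Finset (Fin 8)).card = 4 → l x ≤ r y →
      l y ≤ r x → l x ≤ r x → l y ≤ r y → m ≤ l x → m ≤ l y → r x ≤ M → r y ≤ M →
      ¬ (l 0 < m ∧ l 1 < m ∧ M < r 0 ∧ M < r 1) := by
    rintro x y m M hcard h1 h2 h3 h4 h5 h6 h7 h8 ⟨h9, h10, h11, h12⟩
    exact four (max (l x) (l y)) 0 1 x y hcard (by omega) (by omega) (by omega) (by omega)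
  have e₁ := mid 2 3 m₁ M₁ rfl (by omega) (by omega) (by omega) (by omega) x₁ y₁ z₁ w₁
  have e₂ := mid 4 5 m₂ M₂ rfl (by omega) (by omega) (by omega) (by omega) x₂ y₂ z₂ w₂
  have e₃ := mid 6 7 m₃ M₃ rfl (by omega) (by omega) (by omega) (by omega) x₃ y₃ z₃ w₃
  omega

end IntervalModel

section TwoConnectedModel

variable {W V : Type} {H : SimpleGraph W} {G : SimpleGraph V} {S : Set V}

/-- A model of a 2-connected graph survives on one side of a separating vertex. -/
lemma MinorOn.of_separation (hH : TwoConnOn H Set.univ) {A B : Set V} {v : V}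
    (hm : MinorOn H G (insert v (A ∪ B))) (hvA : v ∉ A) (hvB : v ∉ B)
    (hAB : ∀ x ∈ A, ∀ y ∈ B, ¬ G.Adj x y) :
    MinorOn H G (insert v A) ∨ MinorOn H G (insert v B) := by
  obtain ⟨f, hc, hS, hd, he⟩ := hm
  have side : ∀ w, v ∉ f w → f w ⊆ A ∨ f w ⊆ B := by
    intro w hvw
    have hmem : ∀ x ∈ f w, x ∈ A ∨ x ∈ B := fun x hx =>
      (hS w hx).resolve_left fun e => hvw (e ▸ hx)
    by_contra! hcon
    obtain ⟨p, hp, hpA⟩ := Set.not_subset.1 hcon.1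
    obtain ⟨q, hq, hqB⟩ := Set.not_subset.1 hcon.2
    obtain ⟨x, hx, hxA, y, hy, hyA, hxy⟩ := (hc w).2 A
      ⟨q, hq, (hmem q hq).resolve_right hqB⟩ ⟨p, hp, hpA⟩
    exact hAB x hxA y ((hmem y hy).resolve_left hyA) hxy
  have cross : ∀ T : Set W, ConnOn H T → (∀ w ∈ T, v ∉ f w) →
      (∀ w ∈ T, f w ⊆ A) ∨ ∀ w ∈ T, f w ⊆ B := by
    intro T hT hvT
    by_contra! hcon
    obtain ⟨⟨p, hp, hpA⟩, q, hq, hqB⟩ := hcon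
    obtain ⟨x, hx, hxA, y, hy, hyA, hxy⟩ := hT.2 {w | f w ⊆ A}
      ⟨q, hq, (side q (hvT q hq)).resolve_right hqB⟩ ⟨p, hp, hpA⟩
    obtain ⟨s, hs, t, ht, hst⟩ := he hxy
    exact hAB s (hxA hs) t ((side y (hvT y hy)).resolve_left hyA ht) hst
  have restrict : ∀ (A B : Set V) (w₀ : W), v ∈ f w₀ → (∀ w, f w ⊆ insert v (A ∪ B)) → v ∉ A →
      v ∉ B → (∀ x ∈ A, ∀ y ∈ B, ¬ G.Adj x y) → (∀ w, w ≠ w₀ → f w ⊆ A) →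
      MinorOn H G (insert v A) := by
    classical
    intro A B w₀ hv hS hvA hvB hAB hA
    have hsub : ∀ w, f w ∩ insert v A ⊆ f w := fun w => Set.inter_subset_left
    refine ⟨fun w => f w ∩ insert v A, fun w => ?_, fun w => Set.inter_subset_right,
      fun w w' hww => (hd hww).mono (hsub w) (hsub w'), fun w w' hww => ?_⟩
    · by_cases e : w = w₀
      · subst e
        refine (hc w).inter_of_cut (x := v) ?_ ⟨v, hv, .inl rfl⟩
        rintro x ⟨-, rfl | hxA⟩ y ⟨hy, hyA⟩ hxy
        · rfl
        · exact absurd hxy (hAB x hxA y (by grind))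
      · beta_reduce
        rw [Set.inter_eq_left.2 ((hA w e).trans (Set.subset_insert _ _))]
        exact hc w
    · obtain ⟨x, hx, y, hy, hxy⟩ := he hww
      have key : ∀ w w' x y, w ≠ w₀ → x ∈ f w → y ∈ f w' → G.Adj x y →
          x ∈ insert v A ∧ y ∈ insert v A := by
        intro w w' x y hw hx hy hxy
        have hxA := hA w hw hx
        refine ⟨.inr hxA, ?_⟩
        rcases hS w' hy with h | h | h
        exacts [.inl h, .inr h, absurd hxy (hAB x hxA y h)]
      by_cases e : w = w₀
      · have hw' : w' ≠ w₀ := fun e' => hww.ne (e.trans e'.symm)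
        obtain ⟨h1, h2⟩ := key w' w y x hw' hy hx hxy.symm
        exact ⟨x, ⟨hx, h2⟩, y, ⟨hy, h1⟩, hxy⟩
      · obtain ⟨h1, h2⟩ := key w w' x y e hx hy hxy
        exact ⟨x, ⟨hx, h1⟩, y, ⟨hy, h2⟩, hxy⟩
  by_cases hv : ∃ w₀, v ∈ f w₀
  · obtain ⟨w₀, hv⟩ := hv
    have hvT : ∀ w ∈ Set.univ \ {w₀}, v ∉ f w := fun w hw hvw =>
      Set.disjoint_left.1 (hd hw.2) hvw hv
    rcases cross _ (hH.2 w₀ trivial) hvT with h | h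
    · exact .inl (restrict A B w₀ hv hS hvA hvB hAB fun w hw => h w ⟨trivial, hw⟩)
    · exact .inr (restrict B A w₀ hv (by simpa only [Set.union_comm] using hS) hvB hvA
        (fun x hx y hy hxy => hAB y hy x hx hxy.symm) fun w hw => h w ⟨trivial, hw⟩)
  · push Not at hv
    refine (cross _ hH.connOn fun w _ => hv w).imp (fun h => ?_) fun h => ?_
    · exact ⟨f, hc, fun w => (h w trivial).trans (Set.subset_insert _ _), hd, he⟩
    · exact ⟨f, hc, fun w => (h w trivial).trans (Set.subset_insert _ _), hd, he⟩

lemma exists_separation [Finite V] (h3 : 3 ≤ S.ncard) (hS : ¬ TwoConnOn G S) :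
    ∃ (v : V) (A B : Set V), v ∉ A ∧ v ∉ B ∧ Disjoint A B ∧ insert v (A ∪ B) = S ∧
      (∀ x ∈ A, ∀ y ∈ B, ¬ G.Adj x y) ∧ (insert v A).ncard < S.ncard ∧
      (insert v B).ncard < S.ncard := by
  obtain ⟨v, hv, hconn⟩ : ∃ v ∈ S, ¬ ConnOn G (S \ {v}) := by
    by_contra! hcon
    exact hS ⟨h3, hcon⟩
  obtain ⟨x, hx⟩ : (S \ {v}).Nonempty := by
    rw [← Set.ncard_pos, Set.ncard_sdiff_singleton_of_mem hv]
    omega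
  simp only [ConnOn, not_and, not_forall] at hconn
  obtain ⟨K, ⟨p, hp, hpK⟩, ⟨q, hq, hqK⟩, hcut⟩ := hconn ⟨x, hx⟩
  push Not at hcut
  refine ⟨v, (S \ {v}) ∩ K, (S \ {v}) \ K, by simp, by simp, Set.disjoint_sdiff_inter.symm, ?_,
    fun y hy z hz => hcut y hy.1 hy.2 z hz.1 hz.2, Set.ncard_lt_ncard
    ⟨Set.insert_subset hv fun y hy => hy.1.1, fun h => ?_⟩, Set.ncard_lt_ncard
    ⟨Set.insert_subset hv fun y hy => hy.1.1, fun h => ?_⟩⟩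
  · rw [Set.inter_union_sdiff, Set.insert_sdiff_singleton, Set.insert_eq_of_mem hv]
  · rcases h hq.1 with e | e
    exacts [hq.2 e, hqK e.2]
  · rcases h hp.1 with e | e
    exacts [hp.2 e, e.2 hpK]

/-- A graph with a 2-connected minor has a 2-connected subgraph with the same minor. -/
lemma MinorOn.exists_twoConnOn [Finite V] (hH : TwoConnOn H Set.univ) : ∀ (n : ℕ) (S : Set V),
    S.ncard = n → MinorOn H G S → ∃ S' : Set V, TwoConnOn G S' ∧ MinorOn H G S' := by
  intro n
  induction n using Nat.strong_induction_on with
  | _ n ih =>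
  rintro S rfl hm
  by_cases hS : TwoConnOn G S
  · exact ⟨S, hS, hm⟩
  have hcard : 3 ≤ S.ncard := by
    obtain ⟨f, hc, hfS, hd, -⟩ := hm
    choose g hg using fun w => (hc w).1
    refine hH.1.trans (Set.ncard_le_ncard_of_injOn g (fun w _ => hfS w (hg w)) ?_)
    intro w _ w' _ hww
    by_contra hne
    exact Set.disjoint_left.1 (hd hne) (hg w) (hww ▸ hg w')
  obtain ⟨v, A, B, hvA, hvB, -, rfl, hAB, hA, hB⟩ := exists_separation hcard hS
  rcases hm.of_separation hH hvA hvB hAB with h | h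
  exacts [ih _ hA _ rfl h, ih _ hB _ rfl h]

/-- A graph is connected if iterating a parent map leads every vertex to the root. -/
lemma ConnOn.of_parent {T : Set W} {r : W} (hr : r ∈ T) (f : W → W) (n : ℕ)
    (hf : ∀ x ∈ T, f x ∈ T ∧ (f x = x ∨ H.Adj x (f x))) (hn : ∀ x ∈ T, f^[n] x = r) :
    ConnOn H T := by
  refine ⟨⟨r, hr⟩, ?_⟩
  rintro K ⟨p, hp, hpK⟩ ⟨q, hq, hqK⟩
  by_contra! hcon
  have step : ∀ x ∈ T, (f x ∈ K ↔ x ∈ K) := by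
    intro x hx
    obtain ⟨h1, h2⟩ := hf x hx
    rcases h2 with h2 | h2
    · rw [h2]
    · by_cases hxK : x ∈ K
      · simp only [hxK, iff_true]
        by_contra h3
        exact hcon x hx hxK _ h1 h3 h2
      · simp only [hxK, iff_false]
        exact fun h3 => hcon _ h1 h3 x hx hxK h2.symm
  have iter : ∀ (k : ℕ) (x : W), x ∈ T → f^[k] x ∈ T ∧ (f^[k] x ∈ K ↔ x ∈ K) := by
    intro k
    induction k with
    | zero => exact fun x hx => ⟨hx, Iff.rfl⟩
    | succ k ih =>
      intro x hx
      obtain ⟨h1, h2⟩ := ih (f x) (hf x hx).1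
      exact ⟨h1, h2.trans (step x hx)⟩
  have h1 := (iter n p hp).2
  have h2 := (iter n q hq).2
  rw [hn p hp] at h1
  rw [hn q hq] at h2
  exact hqK (h2.1 (h1.2 hpK))

lemma TwoConnOn.of_parent (h3 : 3 ≤ (Set.univ : Set W).ncard)
    (h : ∀ w, ∃ (r : W) (f : W → W) (n : ℕ), r ≠ w ∧
      ∀ x, x ≠ w → f x ≠ w ∧ (f x = x ∨ H.Adj x (f x)) ∧ f^[n] x = r) :
    TwoConnOn H Set.univ := by
  refine ⟨h3, fun w _ => ?_⟩
  obtain ⟨r, f, n, hr, hf⟩ := h w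
  exact ConnOn.of_parent ⟨trivial, hr⟩ f n (fun x hx => ⟨⟨trivial, (hf x hx.2).1⟩, (hf x hx.2).2.1⟩)
    fun x hx => (hf x hx.2).2.2

instance : DecidableRel K4.Adj := by unfold K4; infer_instance

instance : DecidableRel S3.Adj := by unfold S3; infer_instance

instance : DecidableRel D3.Adj := by unfold D3; infer_instance

lemma twoConnOn_K4 : TwoConnOn K4 Set.univ := by
  refine .of_parent (by simp [Set.ncard_univ]) fun w => ?_
  refine ⟨if w = 0 then 1 else 0, fun _ => if w = 0 then 1 else 0, 1, ?_⟩
  revert w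
  decide

lemma twoConnOn_S3 : TwoConnOn S3 Set.univ := by
  refine .of_parent (by simp [Set.ncard_univ]) fun w => ?_
  refine ⟨if w = 1 then 3 else 1, if w = 1 then ![5, 3, 3, 3, 3, 3] else
    if w = 3 then ![1, 1, 1, 1, 5, 1] else ![1, 1, 1, 1, 3, 1], 2, ?_⟩
  revert w
  decide

lemma twoConnOn_D3 : TwoConnOn D3 Set.univ := by
  refine .of_parent (by simp [Set.ncard_univ]) fun w => ?_
  refine ⟨if w = 0 then 1 else 0, if w = 0 then ![1, 1, 3, 1, 5, 1, 7, 1] else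
    if w = 1 then ![0, 0, 0, 2, 0, 4, 0, 6] else if w = 2 ∨ w = 3 then ![0, 5, 0, 1, 0, 4, 0, 6] else
    ![0, 3, 0, 2, 0, 1, 0, 1], 5, ?_⟩
  revert w
  decide

end TwoConnectedModel

/-! ### Directed spaghetti tree decompositions of width two -/

/-- A connected graph in which every edge is the unique edge across some cut. -/
def CutTree {ι : Type} (T : SimpleGraph ι) : Prop :=
  ConnOn T Set.univ ∧ ∀ x y, T.Adj x y → ∃ X : Set ι, x ∈ X ∧ y ∉ X ∧
    ∀ u ∈ X, ∀ v, v ∉ X → T.Adj u v → u = x ∧ v = y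

/-- A directed spaghetti tree decomposition, of width at most two, of the graph induced by `S`. -/
structure DirSpaghettiOn {V : Type} (G : SimpleGraph V) (S : Set V) where
  ι : Type
  finι : Finite ι
  tree : SimpleGraph ι
  cutTree : CutTree tree
  orient : ι → ι → Prop
  orient_iff : ∀ x y, tree.Adj x y ↔ orient x y ∨ orient y x
  orient_asymm : ∀ x y, orient x y → ¬ orient y x
  bag : ι → Set V
  bag_subset : ∀ x, bag x ⊆ S
  bag_card : ∀ x, (bag x).ncard ≤ 3
  bag_edge : ∀ u ∈ S, ∀ v ∈ S, G.Adj u v → ∃ x, u ∈ bag x ∧ v ∈ bag x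
  bag_conn : ∀ v ∈ S, ConnOn tree {x | v ∈ bag x}
  bag_out : ∀ x y z, orient x y → orient x z → ∀ v, v ∈ bag x → v ∈ bag y → v ∈ bag z → y = z
  bag_in : ∀ x y z, orient y x → orient z x → ∀ v, v ∈ bag x → v ∈ bag y → v ∈ bag z → y = z

section Tree

variable {ι : Type} {T : SimpleGraph ι}

lemma connOn_univ : ConnOn T Set.univ ↔ T.Connected := by
  rw [← connOn_iff_connected_induce]
  exact (SimpleGraph.induceUnivIso T).connected_iff

lemma cutTree_iff_isTree : CutTree T ↔ T.IsTree := by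
  rw [CutTree, connOn_univ, SimpleGraph.isTree_iff,
    SimpleGraph.isAcyclic_iff_forall_adj_isBridge]
  refine and_congr_right fun _ => forall₂_congr fun x y => forall_congr' fun hxy => ?_
  rw [SimpleGraph.isBridge_iff]
  constructor
  · rintro ⟨X, hx, hy, hX⟩ ⟨w⟩
    obtain ⟨d, -, hd1, hd2⟩ := w.exists_boundary_dart X hx hy
    have h := d.adj
    rw [SimpleGraph.deleteEdges_adj] at h
    obtain ⟨h1, h2⟩ := hX _ hd1 _ hd2 h.1
    exact h.2 (by rw [h1, h2]; rfl)
  · intro h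
    refine ⟨{u | (T.deleteEdges {s(x, y)}).Reachable x u}, .rfl, h, fun u hu v hv huv => ?_⟩
    by_contra hne
    have huv' : (T.deleteEdges {s(x, y)}).Adj u v := by
      rw [SimpleGraph.deleteEdges_adj]
      refine ⟨huv, fun he => ?_⟩
      rcases Sym2.eq_iff.1 (Set.mem_singleton_iff.1 he) with e | e
      · exact hne e
      · exact hv (e.2 ▸ .rfl)
    exact hv (SimpleGraph.Reachable.trans hu huv'.reachable)

/-- A cut that meets the tree in a single edge separates the tree into subtrees. -/
lemma CutTree.induce_compl (hT : CutTree T) {X : Set ι} {x y : ι} (hy : y ∉ X)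
    (hX : ∀ u ∈ X, ∀ v, v ∉ X → T.Adj u v → u = x ∧ v = y) : CutTree (T.induce Xᶜ) := by
  constructor
  · rw [connOn_univ, connOn_iff_connected_induce, ← Set.univ_inter Xᶜ]
    refine hT.1.inter_of_cut (x := y) ?_ ⟨y, trivial, hy⟩
    rintro u ⟨-, hu⟩ v ⟨-, hv⟩ huv
    exact (hX v (by simpa using hv) u hu huv.symm).2
  · rintro ⟨a, ha⟩ ⟨b, hb⟩ hab
    obtain ⟨Y, haY, hbY, hY⟩ := hT.2 a b hab
    refine ⟨{z | z.1 ∈ Y}, haY, hbY, fun u hu v hv huv => ?_⟩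
    obtain ⟨h1, h2⟩ := hY u hu v hv huv
    exact ⟨Subtype.ext h1, Subtype.ext h2⟩

/-- An orientation of a finite tree is acyclic. -/
lemma CutTree.exists_sink [Finite ι] (hT : CutTree T) {o : ι → ι → Prop}
    (ho : ∀ x y, o x y → T.Adj x y) (hasymm : ∀ x y, o x y → ¬ o y x) {P : Set ι}
    (hP : P.Nonempty) : ∃ x ∈ P, ∀ y ∈ P, ¬ o x y := by
  by_contra! hcon
  choose! p hpP hp using hcon
  obtain ⟨x, hx⟩ := hP
  have hiter : ∀ n, p^[n] x ∈ P := fun n => by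
    induction n with
    | zero => exact hx
    | succ n ih => rw [Function.iterate_succ_apply']; exact hpP _ ih
  obtain ⟨m, n, hmn, he⟩ := Finite.exists_ne_map_eq_of_infinite fun n : ℕ => p^[n] x
  wlog hlt : m < n generalizing m n
  · exact this n m hmn.symm he.symm (by omega)
  obtain ⟨k, rfl⟩ := Nat.exists_eq_add_of_lt hlt
  have hz := hp _ (hiter m)
  rw [← Function.iterate_succ_apply' p] at hz
  obtain ⟨X, h1, h2, hX⟩ := hT.2 _ _ (ho _ _ hz).symm
  have stay : ∀ j, p^[m + j + 1] x ∈ X := by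
    intro j
    induction j with
    | zero => exact h1
    | succ j ih =>
      by_contra h3
      have h4 := hp _ (hiter (m + j + 1))
      rw [← Function.iterate_succ_apply' p] at h4
      obtain ⟨h5, h6⟩ := hX _ ih _ h3 (ho _ _ h4)
      exact hasymm _ _ hz (h6 ▸ h5 ▸ h4)
  have he' : p^[m] x = p^[m + k + 1] x := he
  exact h2 (he' ▸ stay k)

/-- An orientation of a finite tree with in- and out-degrees at most one is a directed path. -/
lemma CutTree.exists_position [Finite ι] (hT : CutTree T) {o : ι → ι → Prop}
    (ho : ∀ x y, T.Adj x y ↔ o x y ∨ o y x) (hasymm : ∀ x y, o x y → ¬ o y x)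
    (hout : ∀ x y z, o x y → o x z → y = z) (hin : ∀ x y z, o y x → o z x → y = z) :
    ∃ pos : ι → ℤ, Function.Injective pos ∧ ∀ x y, o x y → pos y = pos x + 1 := by
  classical
  obtain ⟨r, -, hr⟩ := hT.exists_sink (o := fun x y => o y x) (fun x y h => (ho x y).2 (.inr h))
    (fun x y h => hasymm y x h) (P := Set.univ) hT.1.1
  replace hr : ∀ x, ¬ o x r := fun x => hr x trivial
  let f : ι → ι := fun x => if h : ∃ y, o x y then h.choose else x
  have hf : ∀ x y, o x y → f x = y := fun x y h => by
    have h' : ∃ y, o x y := ⟨y, h⟩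
    simp only [f, dif_pos h']
    exact hout _ _ _ h'.choose_spec h
  have hf' : ∀ x, f x = x ∨ o x (f x) := fun x => by
    by_cases h : ∃ y, o x y
    · exact .inr (by simp only [f, dif_pos h]; exact h.choose_spec)
    · exact .inl (by simp only [f, dif_neg h])
  have pred : ∀ (k : ℕ) (x : ι), o x (f^[k] r) → ∃ j < k, f^[j] r = x := by
    intro k
    induction k with
    | zero => exact fun x h => absurd h (hr x)
    | succ k ih =>
      intro x h
      rw [Function.iterate_succ_apply'] at h
      rcases hf' (f^[k] r) with e | e
      · obtain ⟨j, hj, hjx⟩ := ih x (e ▸ h)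
        exact ⟨j, by omega, hjx⟩
      · exact ⟨k, by omega, hin _ _ _ e h⟩
  have hall : ∀ x, ∃ k : ℕ, f^[k] r = x := by
    by_contra! hcon
    obtain ⟨x, hx⟩ := hcon
    obtain ⟨u, -, ⟨k, rfl⟩, v, -, hv, huv⟩ := hT.1.2 {x | ∃ k : ℕ, f^[k] r = x}
      ⟨r, trivial, 0, rfl⟩ ⟨x, trivial, fun ⟨k, hk⟩ => hx k hk⟩
    rcases (ho _ _).1 huv with h | h
    · exact hv ⟨k + 1, by rw [Function.iterate_succ_apply', hf _ _ h]⟩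
    · obtain ⟨j, -, hj⟩ := pred k v h
      exact hv ⟨j, hj⟩
  have hpos : ∀ x, f^[Nat.find (hall x)] r = x := fun x => Nat.find_spec (hall x)
  refine ⟨fun x => Nat.find (hall x), fun x y hxy => ?_, fun x y hxy => ?_⟩
  · rw [← hpos x, ← hpos y, Nat.cast_inj.1 hxy]
  · have h1 : Nat.find (hall y) ≤ Nat.find (hall x) + 1 :=
      Nat.find_min' _ (by rw [Function.iterate_succ_apply', hpos x, hf _ _ hxy])
    obtain ⟨j, hj, hjx⟩ := pred _ x ((hpos y).symm ▸ hxy)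
    have h2 : Nat.find (hall x) ≤ j := Nat.find_min' _ hjx
    beta_reduce
    omega

end Tree

section Path

variable {V : Type} {G : SimpleGraph V} {S : Set V}

/-- The restriction of a decomposition to one side of a tree edge. -/
lemma DirSpaghettiOn.exists_restrict (D : DirSpaghettiOn G S) {X : Set D.ι} {x y : D.ι}
    (hx : x ∈ X) (hy : y ∉ X) (hX : ∀ u ∈ X, ∀ v, v ∉ X → D.tree.Adj u v → u = x ∧ v = y)
    (hS : ∀ v ∈ S, ∃ z ∉ X, v ∈ D.bag z) : ∃ D' : DirSpaghettiOn G S, Nat.card D'.ι < Nat.card D.ι := by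
  have := D.finι
  have hyb : ∀ v ∈ S, ∀ z ∈ X, v ∈ D.bag z → v ∈ D.bag y := by
    intro v hv z hz hvz
    obtain ⟨z', hz', hvz'⟩ := hS v hv
    obtain ⟨a, ha, haX, b, hb, hbX, hab⟩ := (D.bag_conn v hv).2 X ⟨z, hvz, hz⟩ ⟨z', hvz', hz'⟩
    exact (hX a haX b hbX hab).2 ▸ hb
  refine ⟨{ ι := {z // z ∈ Xᶜ}
            finι := inferInstance
            tree := D.tree.induce Xᶜ
            cutTree := D.cutTree.induce_compl hy hX
            orient := fun a b => D.orient a b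
            orient_iff := fun a b => D.orient_iff a b
            orient_asymm := fun a b => D.orient_asymm a b
            bag := fun a => D.bag a
            bag_subset := fun a => D.bag_subset a
            bag_card := fun a => D.bag_card a
            bag_edge := fun u hu v hv huv => ?_
            bag_conn := fun v hv => ?_
            bag_out := fun a b c h1 h2 v h3 h4 h5 => Subtype.ext (D.bag_out _ _ _ h1 h2 v h3 h4 h5)
            bag_in := fun a b c h1 h2 v h3 h4 h5 => Subtype.ext (D.bag_in _ _ _ h1 h2 v h3 h4 h5) },
    ?_⟩
  · obtain ⟨z, h1, h2⟩ := D.bag_edge u hu v hv huv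
    by_cases hz : z ∈ X
    · exact ⟨⟨y, hy⟩, hyb u hu z hz h1, hyb v hv z hz h2⟩
    · exact ⟨⟨z, hz⟩, h1, h2⟩
  · obtain ⟨z, hz, hvz⟩ := hS v hv
    have h := (D.bag_conn v hv).inter_of_cut (X := Xᶜ) (x := y) ?_ ⟨z, hvz, hz⟩
    · refine ⟨⟨⟨z, hz⟩, hvz⟩, ?_⟩
      rintro K ⟨p, hp, hpK⟩ ⟨q, hq, hqK⟩
      obtain ⟨a, ha, ⟨a', haK, rfl⟩, b, hb, hbK, hab⟩ := h.2 (Subtype.val '' K)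
        ⟨p, ⟨hp, p.2⟩, p, hpK, rfl⟩ ⟨q, ⟨hq, q.2⟩, fun ⟨q', h1, h2⟩ => hqK (Subtype.ext h2 ▸ h1)⟩
      exact ⟨a', ha.1, haK, ⟨b, hb.2⟩, hb.1, fun h => hbK ⟨_, h, rfl⟩, hab⟩
    · rintro u ⟨-, hu⟩ v ⟨-, hv⟩ huv
      exact (hX v (by simpa using hv) u hu huv.symm).2
  · have := Finite.card_subtype_lt (p := fun z => z ∈ Xᶜ) (x := x) (by simpa using hx)
    exact this

/-- In a smallest decomposition of a 2-connected graph, adjacent bags share two vertices. -/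
lemma DirSpaghettiOn.exists_common_ne (D : DirSpaghettiOn G S) (h2 : TwoConnOn G S)
    (hmin : ∀ D' : DirSpaghettiOn G S, Nat.card D.ι ≤ Nat.card D'.ι) {x y : D.ι}
    (hxy : D.tree.Adj x y) (c : V) : ∃ v ∈ D.bag x, v ∈ D.bag y ∧ v ≠ c := by
  obtain ⟨X, hx, hy, hX⟩ := D.cutTree.2 x y hxy
  obtain ⟨p, hp, hpX⟩ : ∃ p ∈ S, ∀ z, p ∈ D.bag z → z ∈ X := by
    by_contra! hcon
    obtain ⟨D', hD'⟩ := D.exists_restrict hx hy hX fun v hv => by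
      obtain ⟨z, h1, h2⟩ := hcon v hv
      exact ⟨z, h2, h1⟩
    exact absurd (hmin D') (by omega)
  obtain ⟨q, hq, hqX⟩ : ∃ q ∈ S, ∀ z, q ∈ D.bag z → z ∉ X := by
    by_contra! hcon
    obtain ⟨D', hD'⟩ := D.exists_restrict (X := Xᶜ) (x := y) (y := x) hy (by simpa)
      (fun u hu v hv huv => (hX v (by simpa using hv) u hu huv.symm).symm) fun v hv => by
        obtain ⟨z, h1, h2⟩ := hcon v hv
        exact ⟨z, by simpa using h2, h1⟩
    exact absurd (hmin D') (by omega)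
  have key : ∀ u ∈ S, (∀ z, u ∈ D.bag z → z ∈ X) → ∀ v ∈ S, ¬ (∀ z, v ∈ D.bag z → z ∈ X) →
      G.Adj u v → v ∈ D.bag x ∧ v ∈ D.bag y := by
    intro u hu huX v hv hvX huv
    obtain ⟨z, hz1, hz2⟩ := D.bag_edge u hu v hv huv
    push Not at hvX
    obtain ⟨z', hz'1, hz'2⟩ := hvX
    obtain ⟨a, ha, haX, b, hb, hbX, hab⟩ := (D.bag_conn v hv).2 X ⟨z, hz2, huX z hz1⟩
      ⟨z', hz'1, hz'2⟩
    obtain ⟨rfl, rfl⟩ := hX a haX b hbX hab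
    exact ⟨ha, hb⟩
  obtain ⟨z, hz⟩ := (D.bag_conn q hq).1
  have hqK : ¬ ∀ z, q ∈ D.bag z → z ∈ X := fun h => hqX z hz (h z hz)
  by_cases hc : c ∈ S ∧ c ≠ p ∧ c ≠ q
  · obtain ⟨u, hu, huK, -, v, hv, hvK, hvc, huv⟩ := h2.cross hc.1 {u | ∀ z, u ∈ D.bag z → z ∈ X}
      ⟨p, hp, hpX, hc.2.1.symm⟩ ⟨q, hq, hqK, hc.2.2.symm⟩
    obtain ⟨h3, h4⟩ := key u hu huK v hv hvK huv
    exact ⟨v, h3, h4, hvc⟩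
  · obtain ⟨u, hu, huK, v, hv, hvK, huv⟩ := h2.connOn.2 {u | ∀ z, u ∈ D.bag z → z ∈ X}
      ⟨p, hp, hpX⟩ ⟨q, hq, hqK⟩
    obtain ⟨h3, h4⟩ := key u hu huK v hv hvK huv
    refine ⟨v, h3, h4, ?_⟩
    rintro rfl
    have : v ≠ p := fun e => hvK (e ▸ hpX)
    have : v ≠ q := fun e => hqX x (e ▸ h3) hx
    tauto

lemma DirSpaghettiOn.false_of_disjoint_adhesions [Finite V] (D : DirSpaghettiOn G S)
    (h2 : TwoConnOn G S) (hmin : ∀ D' : DirSpaghettiOn G S, Nat.card D.ι ≤ Nat.card D'.ι)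
    {x y z : D.ι} (hxy : D.tree.Adj x y) (hxz : D.tree.Adj x z)
    (hd : ∀ v ∈ D.bag x, v ∈ D.bag y → v ∉ D.bag z) : False := by
  obtain ⟨a, -⟩ := h2.connOn.1
  obtain ⟨b, hb, hb', -⟩ := D.exists_common_ne h2 hmin hxy a
  obtain ⟨b', hb2, hb2', hbb⟩ := D.exists_common_ne h2 hmin hxy b
  obtain ⟨c, hc, hc', -⟩ := D.exists_common_ne h2 hmin hxz a
  obtain ⟨c', hc2, hc2', hcc⟩ := D.exists_common_ne h2 hmin hxz c
  have hbc : ∀ u ∈ D.bag x, u ∈ D.bag y → ∀ v, v ∈ D.bag z → u ≠ v :=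
    fun u h3 h4 v h5 e => hd u h3 h4 (e ▸ h5)
  have hsub : ({b, b', c, c'} : Set V) ⊆ D.bag x := by
    rintro v (rfl | rfl | rfl | rfl) <;> assumption
  have h4 : ({b, b', c, c'} : Set V).ncard = 4 := by
    rw [Set.ncard_eq_succ]
    refine ⟨b, {b', c, c'}, ?_, rfl, ?_⟩
    · rintro (e | e | e)
      exacts [hbb e.symm, hbc b hb hb' c hc' e, hbc b hb hb' c' hc2' e]
    · rw [Set.ncard_eq_three]
      exact ⟨b', c, c', hbc _ hb2 hb2' _ hc', hbc _ hb2 hb2' _ hc2', hcc.symm, rfl⟩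
  have := Set.ncard_le_ncard hsub
  have := D.bag_card x
  omega

/-- A 2-connected graph of directed spaghetti treewidth two has pathwidth two. -/
lemma DirSpaghettiOn.pathRep [Finite V] (D₀ : DirSpaghettiOn G S) (h2 : TwoConnOn G S) :
    PathRep G S ∅ 3 := by
  obtain ⟨D, hmin⟩ : ∃ D : DirSpaghettiOn G S, ∀ D' : DirSpaghettiOn G S,
      Nat.card D.ι ≤ Nat.card D'.ι := by
    have : Nonempty (DirSpaghettiOn G S) := ⟨D₀⟩
    exact ⟨Function.argmin fun D : DirSpaghettiOn G S => Nat.card D.ι,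
      fun D' => Function.argmin_le (fun D : DirSpaghettiOn G S => Nat.card D.ι) D'⟩
  have := D.finι
  obtain ⟨pos, hinj, hpos⟩ := D.cutTree.exists_position D.orient_iff D.orient_asymm
    (fun x y z hy hz => by
      by_contra hne
      exact D.false_of_disjoint_adhesions h2 hmin ((D.orient_iff _ _).2 (.inl hy))
        ((D.orient_iff _ _).2 (.inl hz)) fun v h3 h4 h5 => hne (D.bag_out x y z hy hz v h3 h4 h5))
    (fun x y z hy hz => by
      by_contra hne
      exact D.false_of_disjoint_adhesions h2 hmin ((D.orient_iff _ _).2 (.inr hy))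
        ((D.orient_iff _ _).2 (.inr hz)) fun v h3 h4 h5 => hne (D.bag_in x y z hy hz v h3 h4 h5))
  have : Nonempty D.ι := ⟨D.cutTree.1.1.some⟩
  have hex : ∀ v, ∃ i j, v ∈ S → v ∈ D.bag i ∧ v ∈ D.bag j ∧
      ∀ z, v ∈ D.bag z → pos i ≤ pos z ∧ pos z ≤ pos j := by
    intro v
    by_cases hv : v ∈ S
    · obtain ⟨i, hi, hi'⟩ := Set.exists_min_image {x | v ∈ D.bag x} pos (Set.toFinite _)
        (D.bag_conn v hv).1
      obtain ⟨j, hj, hj'⟩ := Set.exists_max_image {x | v ∈ D.bag x} pos (Set.toFinite _)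
        (D.bag_conn v hv).1
      exact ⟨i, j, fun _ => ⟨hi, hj, fun z hz => ⟨hi' z hz, hj' z hz⟩⟩⟩
    · exact ⟨Classical.arbitrary _, Classical.arbitrary _, fun h => absurd h hv⟩
  choose a b hab using hex
  obtain ⟨N, hN⟩ := (Set.finite_range pos).bddAbove
  refine ⟨fun v => pos (a v), fun v => pos (b v), N, fun v hv => ⟨?_, hN ⟨_, rfl⟩⟩, by simp,
    fun u hu v hv huv => ?_, fun t => ?_⟩
  · exact ((hab v hv).2.2 _ (hab v hv).1).2
  · obtain ⟨z, h3, h4⟩ := D.bag_edge u hu v hv huv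
    exact ((hab u hu).2.2 z h3).1.trans ((hab v hv).2.2 z h4).2
  · have key : ∀ v ∈ S, pos (a v) ≤ t → t ≤ pos (b v) → ∃ z, v ∈ D.bag z ∧ pos z = t := by
      intro v hv h3 h4
      by_contra! hcon
      obtain ⟨x, hx, hxK, y, hy, hyK, hxy⟩ := (D.bag_conn v hv).2 {z | pos z < t}
        ⟨a v, (hab v hv).1, lt_of_le_of_ne h3 (hcon _ (hab v hv).1)⟩
        ⟨b v, (hab v hv).2.1, not_lt.2 h4⟩
      have hne := hcon y hy
      simp only [Set.mem_ofPred_eq] at hxK hyK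
      rcases (D.orient_iff _ _).1 hxy with h | h
      · have := hpos _ _ h
        omega
      · have := hpos _ _ h
        omega
    rcases Set.eq_empty_or_nonempty {v | v ∈ S ∧ pos (a v) ≤ t ∧ t ≤ pos (b v)} with h | ⟨v, hv⟩
    · simp [h]
    · obtain ⟨z, -, hz⟩ := key v hv.1 hv.2.1 hv.2.2
      refine (Set.ncard_le_ncard (t := D.bag z) fun w hw => ?_).trans (D.bag_card z)
      obtain ⟨z', h3, h4⟩ := key w hw.1 hw.2.1 hw.2.2
      exact hinj (hz.trans h4.symm) ▸ h3

end Path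

/-! ### Constructing directed spaghetti tree decompositions -/

lemma ConnOn.image {V W : Type} {G : SimpleGraph V} {H : SimpleGraph W} {S : Set V}
    (h : ConnOn G S) (f : V → W) (hf : ∀ x y, G.Adj x y → H.Adj (f x) (f y)) :
    ConnOn H (f '' S) := by
  refine ⟨h.1.image f, ?_⟩
  rintro K ⟨-, ⟨p, hp, rfl⟩, hpK⟩ ⟨-, ⟨q, hq, rfl⟩, hqK⟩
  obtain ⟨u, hu, huK, v, hv, hvK, huv⟩ := h.2 (f ⁻¹' K) ⟨p, hp, hpK⟩ ⟨q, hq, hqK⟩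
  exact ⟨f u, ⟨u, hu, rfl⟩, huK, f v, ⟨v, hv, rfl⟩, hvK, hf u v huv⟩

section JoinTree

variable {ι κ : Type}

/-- The orientation of the disjoint union of two trees joined by the edge from `a` to `b`. -/
def joinOrient (o : ι → ι → Prop) (o' : κ → κ → Prop) (a : ι) (b : κ) : ι ⊕ κ → ι ⊕ κ → Prop
  | .inl x, .inl y => o x y
  | .inr x, .inr y => o' x y
  | .inl x, .inr y => x = a ∧ y = b
  | .inr _, .inl _ => False

/-- The disjoint union of two graphs joined by the edge `ab`. -/
def joinGraph (T : SimpleGraph ι) (T' : SimpleGraph κ) (a : ι) (b : κ) : SimpleGraph (ι ⊕ κ) where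
  Adj p q := joinOrient T.Adj T'.Adj a b p q ∨ joinOrient T.Adj T'.Adj a b q p
  symm := ⟨fun _ _ h => h.symm⟩
  loopless := ⟨by rintro (x | x) (h | h) <;> exact h.ne rfl⟩

variable {T : SimpleGraph ι} {T' : SimpleGraph κ} {a : ι} {b : κ}

lemma joinGraph_inl_inl {x y : ι} : (joinGraph T T' a b).Adj (.inl x) (.inl y) ↔ T.Adj x y :=
  ⟨fun h => h.elim id SimpleGraph.Adj.symm, .inl⟩

lemma joinGraph_inr_inr {x y : κ} : (joinGraph T T' a b).Adj (.inr x) (.inr y) ↔ T'.Adj x y :=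
  ⟨fun h => h.elim id SimpleGraph.Adj.symm, .inl⟩

lemma joinGraph_inl_inr {x : ι} {y : κ} :
    (joinGraph T T' a b).Adj (.inl x) (.inr y) ↔ x = a ∧ y = b :=
  ⟨fun h => h.elim id False.elim, .inl⟩

lemma joinGraph_inr_inl {x : ι} {y : κ} :
    (joinGraph T T' a b).Adj (.inr y) (.inl x) ↔ x = a ∧ y = b :=
  ⟨fun h => h.elim False.elim id, .inr⟩

lemma ConnOn.join {P : Set ι} {Q : Set κ} (hP : ConnOn T P) (hQ : ConnOn T' Q) (ha : a ∈ P)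
    (hb : b ∈ Q) : ConnOn (joinGraph T T' a b) (Sum.inl '' P ∪ Sum.inr '' Q) :=
  (hP.image Sum.inl fun _ _ => joinGraph_inl_inl.2).union
    (hQ.image Sum.inr fun _ _ => joinGraph_inr_inr.2) ⟨a, ha, rfl⟩ ⟨b, hb, rfl⟩
    (.inr (joinGraph_inl_inr.2 ⟨rfl, rfl⟩))

lemma CutTree.join (hT : CutTree T) (hT' : CutTree T') (a : ι) (b : κ) :
    CutTree (joinGraph T T' a b) := by
  constructor
  · have h := hT.1.join hT'.1 (a := a) (b := b) trivial trivial
    rwa [Set.image_univ, Set.image_univ, Set.range_inl_union_range_inr] at h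
  · rintro (x | x) (y | y) hxy
    · obtain ⟨X, hx, hy, hX⟩ := hT.2 x y (joinGraph_inl_inl.1 hxy)
      refine ⟨{p | p.elim (· ∈ X) fun _ => a ∈ X}, hx, hy, ?_⟩
      rintro (u | u) hu (v | v) hv huv
      · simpa using hX u hu v hv (joinGraph_inl_inl.1 huv)
      · obtain ⟨rfl, rfl⟩ := joinGraph_inl_inr.1 huv
        exact absurd hu hv
      · obtain ⟨rfl, rfl⟩ := joinGraph_inr_inl.1 huv
        exact absurd hu hv
      · exact absurd hu hv
    · obtain ⟨rfl, rfl⟩ := joinGraph_inl_inr.1 hxy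
      refine ⟨Set.range Sum.inl, ⟨_, rfl⟩, by simp, ?_⟩
      rintro - ⟨u, rfl⟩ (v | v) hv huv
      · exact absurd ⟨v, rfl⟩ hv
      · simpa using joinGraph_inl_inr.1 huv
    · obtain ⟨rfl, rfl⟩ := joinGraph_inr_inl.1 hxy
      refine ⟨Set.range Sum.inr, ⟨_, rfl⟩, by simp, ?_⟩
      rintro - ⟨u, rfl⟩ (v | v) hv huv
      · simpa using (joinGraph_inr_inl.1 huv).symm
      · exact absurd ⟨v, rfl⟩ hv
    · obtain ⟨X, hx, hy, hX⟩ := hT'.2 x y (joinGraph_inr_inr.1 hxy)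
      refine ⟨{p | p.elim (fun _ => b ∈ X) (· ∈ X)}, hx, hy, ?_⟩
      rintro (u | u) hu (v | v) hv huv
      · exact absurd hu hv
      · obtain ⟨rfl, rfl⟩ := joinGraph_inl_inr.1 huv
        exact absurd hu hv
      · obtain ⟨rfl, rfl⟩ := joinGraph_inr_inl.1 huv
        exact absurd hu hv
      · simpa using hX u hu v hv (joinGraph_inr_inr.1 huv)

end JoinTree

section Construction

variable {V : Type} {G : SimpleGraph V} {S : Set V}

/-- Two decompositions of graphs that share a single vertex can be joined. -/
lemma DirSpaghettiOn.nonempty_insert_union {A B : Set V} {v : V} (D : DirSpaghettiOn G (insert v A))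
    (D' : DirSpaghettiOn G (insert v B)) (hvA : v ∉ A) (hvB : v ∉ B) (hd : Disjoint A B)
    (hAB : ∀ x ∈ A, ∀ y ∈ B, ¬ G.Adj x y) : Nonempty (DirSpaghettiOn G (insert v (A ∪ B))) := by
  have := D.finι
  have := D'.finι
  obtain ⟨a, ha, hamax⟩ := D.cutTree.exists_sink (fun x y h => (D.orient_iff x y).2 (.inl h))
    D.orient_asymm (D.bag_conn v (.inl rfl)).1
  obtain ⟨b, hb, hbmin⟩ := D'.cutTree.exists_sink (o := fun x y => D'.orient y x)
    (fun x y h => (D'.orient_iff x y).2 (.inr h)) (fun x y h => D'.orient_asymm y x h)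
    (D'.bag_conn v (.inl rfl)).1
  have hv : ∀ u x y, u ∈ D.bag x → u ∈ D'.bag y → u = v := by
    intro u x y h1 h2
    rcases D.bag_subset x h1 with h | h
    · exact h
    · exact (D'.bag_subset y h2).resolve_right fun h' => Set.disjoint_left.1 hd h h'
  have hbag : ∀ u, {p : D.ι ⊕ D'.ι | u ∈ p.elim D.bag D'.bag} =
      Sum.inl '' {x | u ∈ D.bag x} ∪ Sum.inr '' {y | u ∈ D'.bag y} := by
    intro u
    ext (x | x) <;> simp
  refine ⟨{ ι := D.ι ⊕ D'.ι
            finι := inferInstance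
            tree := joinGraph D.tree D'.tree a b
            cutTree := D.cutTree.join D'.cutTree a b
            orient := joinOrient D.orient D'.orient a b
            orient_iff := ?_
            orient_asymm := ?_
            bag := fun p => p.elim D.bag D'.bag
            bag_subset := ?_
            bag_card := ?_
            bag_edge := ?_
            bag_conn := ?_
            bag_out := ?_
            bag_in := ?_ }⟩
  · rintro (x | x) (y | y)
    · exact joinGraph_inl_inl.trans (D.orient_iff x y)
    · exact joinGraph_inl_inr.trans ⟨.inl, fun h => h.elim id False.elim⟩
    · exact joinGraph_inr_inl.trans ⟨.inr, fun h => h.elim False.elim id⟩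
    · exact joinGraph_inr_inr.trans (D'.orient_iff x y)
  · rintro (x | x) (y | y) h
    · exact D.orient_asymm x y h
    · exact id
    · exact h.elim
    · exact D'.orient_asymm x y h
  · rintro (x | x)
    · exact (D.bag_subset x).trans (Set.insert_subset_insert Set.subset_union_left)
    · exact (D'.bag_subset x).trans (Set.insert_subset_insert Set.subset_union_right)
  · rintro (x | x)
    exacts [D.bag_card x, D'.bag_card x]
  · intro u hu w hw huw
    have h : (u ∈ insert v A ∧ w ∈ insert v A) ∨ (u ∈ insert v B ∧ w ∈ insert v B) := by
      have := hAB u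
      have := hAB w
      have := huw.symm
      simp only [Set.mem_insert_iff, Set.mem_union] at *
      grind
    rcases h with ⟨h1, h2⟩ | ⟨h1, h2⟩
    · obtain ⟨x, hx⟩ := D.bag_edge u h1 w h2 huw
      exact ⟨.inl x, hx⟩
    · obtain ⟨x, hx⟩ := D'.bag_edge u h1 w h2 huw
      exact ⟨.inr x, hx⟩
  · intro u hu
    rw [hbag]
    by_cases h1 : u ∈ insert v A
    · by_cases h2 : u ∈ insert v B
      · have : u = v := by
          rcases h1 with h | h
          · exact h
          · exact h2.resolve_right fun h' => Set.disjoint_left.1 hd h h'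
        subst this
        exact (D.bag_conn u h1).join (D'.bag_conn u h2) ha hb
      · have : {y | u ∈ D'.bag y} = ∅ :=
          Set.eq_empty_of_forall_notMem fun y hy => h2 (D'.bag_subset y hy)
        rw [this, Set.image_empty, Set.union_empty]
        exact (D.bag_conn u h1).image _ fun _ _ => joinGraph_inl_inl.2
    · have h2 : u ∈ insert v B := by
        simp only [Set.mem_insert_iff, Set.mem_union] at *
        tauto
      have : {y | u ∈ D.bag y} = ∅ :=
        Set.eq_empty_of_forall_notMem fun y hy => h1 (D.bag_subset y hy)
      rw [this, Set.image_empty, Set.empty_union]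
      exact (D'.bag_conn u h2).image _ fun _ _ => joinGraph_inr_inr.2
  · have cross : ∀ x y z, D.orient x y → x = a → ∀ u, u ∈ D.bag y → u ∉ D'.bag z := by
      rintro x y z h rfl u h1 h2
      exact hamax y (hv u y z h1 h2 ▸ h1) h
    rintro (x | x) (y | y) (z | z) h1 h2 u hx hy hz
    · exact congrArg _ (D.bag_out x y z h1 h2 u hx hy hz)
    · exact (cross x y z h1 h2.1 u hy hz).elim
    · exact (cross x z y h2 h1.1 u hz hy).elim
    · exact congrArg _ (h1.2.trans h2.2.symm)
    · exact h1.elim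
    · exact h1.elim
    · exact h2.elim
    · exact congrArg _ (D'.bag_out x y z h1 h2 u hx hy hz)
  · have cross : ∀ x y z, D'.orient y x → x = b → ∀ u, u ∈ D'.bag y → u ∉ D.bag z := by
      rintro x y z h rfl u h1 h2
      exact hbmin y (hv u z y h2 h1 ▸ h1) h
    rintro (x | x) (y | y) (z | z) h1 h2 u hx hy hz
    · exact congrArg _ (D.bag_in x y z h1 h2 u hx hy hz)
    · exact h2.elim
    · exact h1.elim
    · exact h1.elim
    · exact congrArg _ (h1.1.trans h2.1.symm)
    · exact (cross x z y h2 h1.2 u hz hy).elim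
    · exact (cross x y z h1 h2.2 u hy hz).elim
    · exact congrArg _ (D'.bag_in x y z h1 h2 u hx hy hz)

lemma exists_succ_crossing (K : Set ℤ) : ∀ (d : ℕ) (p : ℤ), p ∈ K → p + d ∉ K →
    ∃ i, p ≤ i ∧ i + 1 ≤ p + d ∧ i ∈ K ∧ i + 1 ∉ K := by
  intro d
  induction d with
  | zero => exact fun p h1 h2 => absurd h1 (by simpa using h2)
  | succ d ih =>
    intro p h1 h2
    by_cases h3 : p + d ∈ K
    · exact ⟨p + d, by omega, by push_cast; omega, h3, by push_cast at h2; rwa [add_assoc]⟩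
    · obtain ⟨i, h4, h5, h6⟩ := ih p h1 h3
      exact ⟨i, h4, by push_cast; omega, h6⟩

/-- The path on the integers between `-M` and `M`. -/
def intPath (M : ℤ) : SimpleGraph (Set.Icc (-M) M) where
  Adj s t := s.1 + 1 = t.1 ∨ t.1 + 1 = s.1
  symm := ⟨fun _ _ h => h.symm⟩
  loopless := ⟨fun _ h => by omega⟩

lemma connOn_intPath {M a b : ℤ} (h1 : -M ≤ a) (h2 : a ≤ b) (h3 : b ≤ M) :
    ConnOn (intPath M) {t | a ≤ t.1 ∧ t.1 ≤ b} := by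
  refine ⟨⟨⟨a, h1, h2.trans h3⟩, le_rfl, h2⟩, ?_⟩
  rintro K ⟨p, hp, hpK⟩ ⟨q, hq, hqK⟩
  have cross : ∀ (K : Set (Set.Icc (-M) M)) (p q : Set.Icc (-M) M), a ≤ p.1 → q.1 ≤ b → p ∈ K →
      q ∉ K → p.1 ≤ q.1 → ∃ u ∈ {t : Set.Icc (-M) M | a ≤ t.1 ∧ t.1 ≤ b}, u ∈ K ∧
        ∃ v ∈ {t : Set.Icc (-M) M | a ≤ t.1 ∧ t.1 ≤ b}, v ∉ K ∧ (intPath M).Adj u v := by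
    intro K p q hp hq hpK hqK hpq
    obtain ⟨i, h4, h5, ⟨u, huK, rfl⟩, h7⟩ := exists_succ_crossing (Subtype.val '' K)
      (q.1 - p.1).toNat p.1 ⟨p, hpK, rfl⟩ (by
        rintro ⟨x, hx, e⟩
        exact hqK (by rwa [show q = x from Subtype.ext (by omega)]))
    refine ⟨u, ⟨by omega, by omega⟩, huK, ⟨u.1 + 1, by omega, by omega⟩,
      ⟨by dsimp only; omega, by dsimp only; omega⟩, fun h => h7 ⟨_, h, rfl⟩, .inl rfl⟩
  rcases le_total p.1 q.1 with h | h
  · exact cross K p q hp.1 hq.2 hpK hqK h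
  · obtain ⟨u, hu, huK, v, hv, hvK, huv⟩ := cross Kᶜ q p hq.1 hp.2 hqK (by simpa) h
    exact ⟨v, hv, by simpa using hvK, u, hu, huK, huv.symm⟩

lemma cutTree_intPath {M : ℤ} (hM : 0 ≤ M) : CutTree (intPath M) := by
  constructor
  · convert connOn_intPath (M := M) le_rfl (by omega) le_rfl
    ext t
    exact ⟨fun _ => t.2, fun _ => trivial⟩
  · rintro x y (h | h)
    · refine ⟨{t | t.1 ≤ x.1}, Set.mem_ofPred.2 le_rfl, fun h' => ?_, ?_⟩
      · rw [Set.mem_ofPred] at h'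
        omega
      rintro u hu v hv (e | e) <;> simp only [Set.mem_ofPred_eq] at hu hv <;>
        constructor <;> apply Subtype.ext <;> omega
    · refine ⟨{t | x.1 ≤ t.1}, Set.mem_ofPred.2 le_rfl, fun h' => ?_, ?_⟩
      · rw [Set.mem_ofPred] at h'
        omega
      rintro u hu v hv (e | e) <;> simp only [Set.mem_ofPred_eq] at hu hv <;>
        constructor <;> apply Subtype.ext <;> omega

lemma PathRep.nonempty_dirSpaghettiOn [Finite V] (h : PathRep G S ∅ 3) :
    Nonempty (DirSpaghettiOn G S) := by
  obtain ⟨l, r, N, h1, -, h3, h4⟩ := h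
  obtain ⟨N', hN'⟩ := (Set.finite_range l).bddBelow
  have hl : ∀ v, N' ≤ l v := fun v => hN' ⟨v, rfl⟩
  have hM : ∃ M : ℤ, 0 ≤ M ∧ -M ≤ N' ∧ N ≤ M := ⟨|N| + |N'|, by positivity, by grind, by grind⟩
  obtain ⟨M, hM0, hM1, hM2⟩ := hM
  refine ⟨{ ι := Set.Icc (-M) M
            finι := inferInstance
            tree := intPath M
            cutTree := cutTree_intPath hM0
            orient := fun s t => s.1 + 1 = t.1
            orient_iff := fun s t => Iff.rfl
            orient_asymm := fun s t h => by omega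
            bag := fun t => {v | v ∈ S ∧ l v ≤ t.1 ∧ t.1 ≤ r v}
            bag_subset := fun t v hv => hv.1
            bag_card := fun t => h4 t.1
            bag_edge := fun u hu v hv huv => ?_
            bag_conn := fun v hv => ?_
            bag_out := fun x y z h5 h6 _ _ _ _ => Subtype.ext (by omega)
            bag_in := fun x y z h5 h6 _ _ _ _ => Subtype.ext (by omega) }⟩
  · have := h3 u hu v hv huv
    have := h3 v hv u hu huv.symm
    have := h1 u hu
    have := h1 v hv
    have := hl u
    have := hl v
    refine ⟨⟨max (l u) (l v), by omega, by omega⟩, ⟨hu, ?_⟩, hv, ?_⟩ <;> dsimp only <;> omega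
  · have := h1 v hv
    have := hl v
    simpa only [Set.mem_ofPred_eq, hv, true_and] using
      connOn_intPath (M := M) (a := l v) (b := r v) (by omega) (by omega) (by omega)

lemma nonempty_dirSpaghettiOn_of_ncard_le (h : S.ncard ≤ 3) : Nonempty (DirSpaghettiOn G S) :=
  ⟨{ ι := Unit
     finι := inferInstance
     tree := ⊥
     cutTree := ⟨by rw [Set.univ_unique]; exact .singleton _, fun _ _ h => h.elim⟩
     orient := fun _ _ => False
     orient_iff := fun _ _ => by simp
     orient_asymm := fun _ _ h => h.elim
     bag := fun _ => S
     bag_subset := fun _ => subset_rfl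
     bag_card := fun _ => h
     bag_edge := fun u hu v hv _ => ⟨(), hu, hv⟩
     bag_conn := fun v hv => by
       rw [show {_x : Unit | v ∈ S} = {()} by ext; simp [hv]]
       exact .singleton _
     bag_out := fun _ _ _ _ _ _ _ _ _ => rfl
     bag_in := fun _ _ _ _ _ _ _ _ _ => rfl }⟩

theorem nonempty_dirSpaghettiOn_of_not_minorOn [Finite V] : ∀ (n : ℕ) (S : Set V), S.ncard = n →
    ¬ MinorOn K4 G S → ¬ MinorOn D3 G S → ¬ MinorOn S3 G S → Nonempty (DirSpaghettiOn G S) := by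
  intro n
  induction n using Nat.strong_induction_on with
  | _ n ih =>
  rintro S rfl hK4 hD3 hS3
  rcases le_total S.ncard 3 with h3 | h3
  · exact nonempty_dirSpaghettiOn_of_ncard_le h3
  by_cases hS : TwoConnOn G S
  · exact (hS.pathRep hK4 hD3 hS3).nonempty_dirSpaghettiOn
  obtain ⟨v, A, B, hvA, hvB, hd, rfl, hAB, hA, hB⟩ := exists_separation h3 hS
  have hA' : insert v A ⊆ insert v (A ∪ B) := Set.insert_subset_insert Set.subset_union_left
  have hB' : insert v B ⊆ insert v (A ∪ B) := Set.insert_subset_insert Set.subset_union_right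
  obtain ⟨D⟩ := ih _ hA _ rfl (fun h => hK4 (h.mono hA')) (fun h => hD3 (h.mono hA'))
    fun h => hS3 (h.mono hA')
  obtain ⟨D'⟩ := ih _ hB _ rfl (fun h => hK4 (h.mono hB')) (fun h => hD3 (h.mono hB'))
    fun h => hS3 (h.mono hB')
  exact D.nonempty_insert_union D' hvA hvB hd hAB

end Construction

/-! ### Translation to the global notions -/

section Width

variable {V : Type} {G : SimpleGraph V} {S : Set V}

lemma DirSpaghettiOn.nonempty_mono [Finite V] {S' : Set V} (D : DirSpaghettiOn G S) (h : S' ⊆ S) :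
    Nonempty (DirSpaghettiOn G S') :=
  ⟨{ D with
     bag := fun x => D.bag x ∩ S'
     bag_subset := fun _ => Set.inter_subset_right
     bag_card := fun x => (Set.ncard_le_ncard Set.inter_subset_left).trans (D.bag_card x)
     bag_edge := fun u hu v hv huv =>
       (D.bag_edge u (h hu) v (h hv) huv).imp fun _ hx => ⟨⟨hx.1, hu⟩, hx.2, hv⟩
     bag_conn := fun v hv => by simpa [hv] using D.bag_conn v (h hv)
     bag_out := fun x y z h1 h2 v h3 h4 h5 => D.bag_out x y z h1 h2 v h3.1 h4.1 h5.1
     bag_in := fun x y z h1 h2 v h3 h4 h5 => D.bag_in x y z h1 h2 v h3.1 h4.1 h5.1 }⟩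

lemma isDirPathSet_of_degree_le_one {ι : Type} [Finite ι] {T : SimpleGraph ι} {o : ι → ι → Prop}
    {P : Set ι} (ho : ∀ x y, T.Adj x y ↔ o x y ∨ o y x) (hP : ConnOn T P)
    (hout : ∀ x ∈ P, ∀ y ∈ P, ∀ z ∈ P, o x y → o x z → y = z)
    (hin : ∀ x ∈ P, ∀ y ∈ P, ∀ z ∈ P, o y x → o z x → y = z) : IsDirPathSet T o P := by
  have h1 : ∀ x ∈ P, {y | y ∈ P ∧ o x y}.ncard ≤ 1 := fun x hx => by
    rw [Set.ncard_le_one]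
    exact fun y hy z hz => hout x hx y hy.1 z hz.1 hy.2 hz.2
  have h2 : ∀ x ∈ P, {y | y ∈ P ∧ o y x}.ncard ≤ 1 := fun x hx => by
    rw [Set.ncard_le_one]
    exact fun y hy z hz => hin x hx y hy.1 z hz.1 hy.2 hz.2
  refine ⟨⟨(connOn_iff_connected_induce P).2 hP, fun x hx => ?_⟩, h1, h2⟩
  have h3 : {y | y ∈ P ∧ T.Adj x y} = {y | y ∈ P ∧ o x y} ∪ {y | y ∈ P ∧ o y x} := by
    ext y
    simp only [Set.mem_ofPred_eq, Set.mem_union, ho]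
    tauto
  have h4 := Set.ncard_union_le {y | y ∈ P ∧ o x y} {y | y ∈ P ∧ o y x}
  have h5 := h1 x hx
  have h6 := h2 x hx
  rw [h3]
  omega

lemma dptw_le_two_iff [Finite V] : dptw G ≤ 2 ↔ Nonempty (DirSpaghettiOn G Set.univ) := by
  constructor
  · intro h
    have hne : {k | ∃ td : DirSpaghettiTD G, ∀ x, (td.bag x).ncard ≤ k + 1}.Nonempty := by
      have hconn : ∀ v : V, ConnOn (⊥ : SimpleGraph Unit) {_x | v ∈ (Set.univ : Set V)} := fun v => by
        rw [show {_x : Unit | v ∈ (Set.univ : Set V)} = {()} by ext; simp]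
        exact .singleton _
      have hor : ∀ x y, (⊥ : SimpleGraph Unit).Adj x y ↔ False ∨ False := fun _ _ => by simp
      refine ⟨(Set.univ : Set V).ncard, ?_, ?_⟩
      · exact
          { ι := Unit
            finι := inferInstance
            tree := ⊥
            isTree := cutTree_iff_isTree.1
              ⟨by rw [Set.univ_unique]; exact .singleton _, fun _ _ h => h.elim⟩
            bag := fun _ => Set.univ
            bag_cover := fun v => ⟨(), trivial⟩
            bag_edge := fun u v _ => ⟨(), trivial, trivial⟩
            bag_conn := fun v => (connOn_iff_connected_induce _).2 (hconn v)
            orient := fun _ _ => False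
            orient_iff := hor
            orient_asymm := fun _ _ h => h.elim
            bag_dirpath := fun v => isDirPathSet_of_degree_le_one hor (hconn v)
              (fun _ _ _ _ _ _ _ _ => rfl) fun _ _ _ _ _ _ _ _ => rfl }
      · exact fun _ => Nat.le_succ _
    obtain ⟨td, htd⟩ := Nat.sInf_mem hne
    have := td.finι
    refine ⟨{ ι := td.ι
              finι := td.finι
              tree := td.tree
              cutTree := cutTree_iff_isTree.2 td.isTree
              orient := td.orient
              orient_iff := td.orient_iff
              orient_asymm := td.orient_asymm
              bag := td.bag
              bag_subset := fun _ => Set.subset_univ _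
              bag_card := fun x => (htd x).trans (Nat.succ_le_succ h)
              bag_edge := fun u _ v _ huv => td.bag_edge huv
              bag_conn := fun v _ => (connOn_iff_connected_induce _).1 (td.bag_conn v)
              bag_out := fun x y z h1 h2 v h3 h4 h5 => ?_
              bag_in := fun x y z h1 h2 v h3 h4 h5 => ?_ }⟩
    · exact (Set.ncard_le_one (Set.toFinite _)).1 ((td.bag_dirpath v).2.1 x h3) y ⟨h4, h1⟩ z ⟨h5, h2⟩
    · exact (Set.ncard_le_one (Set.toFinite _)).1 ((td.bag_dirpath v).2.2 x h3) y ⟨h4, h1⟩ z ⟨h5, h2⟩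
  · rintro ⟨D⟩
    have := D.finι
    exact Nat.sInf_le ⟨
      { ι := D.ι
        finι := D.finι
        tree := D.tree
        isTree := cutTree_iff_isTree.1 D.cutTree
        bag := D.bag
        bag_cover := fun v => (D.bag_conn v trivial).1
        bag_edge := fun u v => D.bag_edge u trivial v trivial
        bag_conn := fun v => (connOn_iff_connected_induce _).2 (D.bag_conn v trivial)
        orient := D.orient
        orient_iff := D.orient_iff
        orient_asymm := D.orient_asymm
        bag_dirpath := fun v => isDirPathSet_of_degree_le_one D.orient_iff (D.bag_conn v trivial)
          (fun x hx y hy z hz h1 h2 => D.bag_out x y z h1 h2 v hx hy hz)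
          fun x hx y hy z hz h1 h2 => D.bag_in x y z h1 h2 v hx hy hz }, D.bag_card⟩

lemma pathRep_iff_exists_pathDecomp [Finite V] {k : ℕ} :
    PathRep G S ∅ k ↔ ∃ pd : PathDecomp (G.induce S), ∀ i, (pd.bag i).ncard ≤ k := by
  constructor
  · rintro ⟨l, r, N, h1, -, h3, h4⟩
    obtain ⟨N', hN'⟩ := (Set.finite_range l).bddBelow
    have hl : ∀ v, N' ≤ l v := fun v => hN' ⟨v, rfl⟩
    have hex : ∀ t, N' ≤ t → t ≤ N → ∃ i : Fin ((N - N').toNat + 1), N' + (i : ℕ) = t :=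
      fun t h5 h6 => ⟨⟨(t - N').toNat, by omega⟩, by dsimp only; omega⟩
    refine ⟨{ m := (N - N').toNat + 1
              hm := by omega
              bag := fun i => {v | l v ≤ N' + (i : ℕ) ∧ N' + (i : ℕ) ≤ r v}
              bag_cover := fun v => ?_
              bag_edge := fun u v huv => ?_
              bag_convex := fun v i j n h5 h6 h7 h8 => ?_ }, fun i => ?_⟩
    · have := h1 v v.2
      have := hl v
      obtain ⟨i, hi⟩ := hex (l v) (by omega) (by omega)
      exact ⟨i, by rw [Set.mem_ofPred, hi]; omega⟩
    · have := h3 u u.2 v v.2 huv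
      have := h3 v v.2 u u.2 huv.symm
      have := h1 u u.2
      have := h1 v v.2
      have := hl u
      have := hl v
      obtain ⟨i, hi⟩ := hex (max (l u) (l v)) (by omega) (by omega)
      exact ⟨i, by rw [Set.mem_ofPred, hi]; omega, by rw [Set.mem_ofPred, hi]; omega⟩
    · rw [Set.mem_ofPred] at *
      have := Fin.le_def.1 h5
      have := Fin.le_def.1 h6
      omega
    · refine le_trans ?_ (h4 (N' + (i : ℕ)))
      rw [← Set.ncard_image_of_injective _ Subtype.val_injective]
      refine Set.ncard_le_ncard ?_
      rintro - ⟨v, hv, rfl⟩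
      exact ⟨v.2, hv⟩
  · rintro ⟨pd, hpd⟩
    have hex : ∀ v, ∃ a b : Fin pd.m, ∀ hv : v ∈ S, ∀ i, ⟨v, hv⟩ ∈ pd.bag i ↔ a ≤ i ∧ i ≤ b := by
      intro v
      by_cases hv : v ∈ S
      · have hne : {i | (⟨v, hv⟩ : S) ∈ pd.bag i}.Nonempty := pd.bag_cover ⟨v, hv⟩
        obtain ⟨a, ha, ha'⟩ := Set.exists_min_image {i | ⟨v, hv⟩ ∈ pd.bag i} id (Set.toFinite _) hne
        obtain ⟨b, hb, hb'⟩ := Set.exists_max_image {i | ⟨v, hv⟩ ∈ pd.bag i} id (Set.toFinite _) hne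
        exact ⟨a, b, fun _ i => ⟨fun h => ⟨ha' i h, hb' i h⟩,
          fun h => pd.bag_convex _ a i b h.1 h.2 ha hb⟩⟩
      · exact ⟨⟨0, pd.hm⟩, ⟨0, pd.hm⟩, fun h => absurd h hv⟩
    choose a b hab using hex
    refine ⟨fun v => (a v : ℕ), fun v => (b v : ℕ), pd.m, fun v hv => ?_, by simp,
      fun u hu v hv huv => ?_, fun t => ?_⟩
    · obtain ⟨i, hi⟩ := pd.bag_cover ⟨v, hv⟩
      have h1 := (hab v hv i).1 hi
      have h2 := Fin.le_def.1 (h1.1.trans h1.2)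
      have := (b v).2
      dsimp only
      omega
    · obtain ⟨i, hi, hi'⟩ := pd.bag_edge (u := ⟨u, hu⟩) (v := ⟨v, hv⟩) huv
      have h1 := Fin.le_def.1 (((hab u hu i).1 hi).1.trans ((hab v hv i).1 hi').2)
      dsimp only
      omega
    · rcases Set.eq_empty_or_nonempty {v | v ∈ S ∧ ((a v : ℕ) : ℤ) ≤ t ∧ t ≤ ((b v : ℕ) : ℤ)} with
        h | ⟨v, hv⟩
      · simp [h]
      · have hlt := (b v).2
        have h0 := hv.2
        refine le_trans ?_ (hpd ⟨t.toNat, by omega⟩)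
        rw [← Set.ncard_image_of_injective _ Subtype.val_injective]
        refine Set.ncard_le_ncard fun w hw => ⟨⟨w, hw.1⟩, (hab w hw.1 _).2 ⟨?_, ?_⟩, rfl⟩
        · have : ((a w : ℕ) : ℤ) ≤ t := hw.2.1
          rw [Fin.le_def]
          dsimp only
          omega
        · have : t ≤ ((b w : ℕ) : ℤ) := hw.2.2
          rw [Fin.le_def]
          dsimp only
          omega

lemma pw_induce_le_iff [Finite V] {k : ℕ} : pw (G.induce S) ≤ k ↔ PathRep G S ∅ (k + 1) := by
  rw [pathRep_iff_exists_pathDecomp]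
  constructor
  · intro h
    have hne : {k | ∃ pd : PathDecomp (G.induce S), ∀ i, (pd.bag i).ncard ≤ k + 1}.Nonempty :=
      ⟨(Set.univ : Set S).ncard,
        { m := 1
          hm := one_pos
          bag := fun _ => Set.univ
          bag_cover := fun _ => ⟨0, trivial⟩
          bag_edge := fun _ _ _ => ⟨0, trivial, trivial⟩
          bag_convex := fun _ _ _ _ _ _ _ _ => trivial }, fun _ => Nat.le_succ _⟩
    obtain ⟨pd, hpd⟩ := Nat.sInf_mem hne
    exact ⟨pd, fun i => (hpd i).trans (Nat.succ_le_succ h)⟩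
  · exact fun h => Nat.sInf_le h

lemma TwoConnOn.not_pathRep_two [Finite V] (h2 : TwoConnOn G S) : ¬ PathRep G S ∅ 2 := by
  rintro ⟨l, r, N, h1, -, h3, h4⟩
  obtain ⟨v, hv, hmin⟩ := Set.exists_min_image S r (Set.toFinite _) h2.connOn.1
  have nbr : ∀ u, u ≠ v → ∃ w ∈ S, w ≠ u ∧ w ≠ v ∧ G.Adj v w := by
    intro u huv
    have hc : ∃ w ∈ S, w ∉ ({u, v} : Set V) := by
      by_contra! hcon
      have := Set.ncard_le_ncard (s := S) (t := {u, v}) hcon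
      rw [Set.ncard_pair huv] at this
      have := h2.1
      omega
    obtain ⟨w, hw, hwuv⟩ := hc
    simp only [Set.mem_insert_iff, Set.mem_singleton_iff, not_or] at hwuv
    obtain ⟨p, hp, rfl, -, q, hq, hqv, hqu, hpq⟩ | hu : (∃ p ∈ S, p = v ∧ p ≠ u ∧ ∃ q ∈ S, q ≠ v ∧
        q ≠ u ∧ G.Adj p q) ∨ u ∉ S := by
      by_cases hu : u ∈ S
      · exact .inl (h2.cross hu {v} ⟨v, hv, rfl, huv.symm⟩ ⟨w, hw, hwuv.2, hwuv.1⟩)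
      · exact .inr hu
    · exact ⟨q, hq, hqu, hqv, hpq⟩
    · obtain ⟨p, hp, rfl, q, hq, hqv, hpq⟩ := h2.connOn.2 {v} ⟨v, hv, rfl⟩ ⟨w, hw, hwuv.2⟩
      exact ⟨q, hq, fun e => hu (e ▸ hq), hqv, hpq⟩
  obtain ⟨w₀, hw₀, hne⟩ : ∃ w ∈ S, w ≠ v := by
    by_contra! hcon
    have := Set.ncard_le_ncard (s := S) (t := {v}) hcon
    rw [Set.ncard_singleton] at this
    have := h2.1
    omega
  obtain ⟨a, ha, -, hav, hva⟩ := nbr w₀ hne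
  obtain ⟨b, hb, hba, hbv, hvb⟩ := nbr a hav
  have h5 : ({v, a, b} : Set V).ncard ≤ 2 := by
    refine (Set.ncard_le_ncard ?_).trans (h4 (r v))
    rintro x (rfl | rfl | rfl)
    · exact ⟨hv, (h1 _ hv).1, le_rfl⟩
    · exact ⟨ha, h3 _ ha _ hv hva.symm, hmin _ ha⟩
    · exact ⟨hb, h3 _ hb _ hv hvb.symm, hmin _ hb⟩
  rw [Set.ncard_eq_three.2 ⟨v, a, b, hav.symm, hbv.symm, hba.symm, rfl⟩] at h5
  omega

lemma connOn_induce_iff {A : Set S} : ConnOn (G.induce S) A ↔ ConnOn G (Subtype.val '' A) := by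
  refine ⟨fun h => h.image _ fun _ _ h => h, fun h => ⟨Set.image_nonempty.1 h.1, ?_⟩⟩
  rintro K ⟨p, hp, hpK⟩ ⟨q, hq, hqK⟩
  obtain ⟨-, ⟨u, hu, rfl⟩, ⟨u', huK, e⟩, -, ⟨v, hv, rfl⟩, hvK, huv⟩ := h.2 (Subtype.val '' K)
    ⟨p, ⟨p, hp, rfl⟩, p, hpK, rfl⟩ ⟨q, ⟨q, hq, rfl⟩, fun ⟨q', h1, h2⟩ => hqK (Subtype.ext h2 ▸ h1)⟩
  exact ⟨u, hu, Subtype.ext e ▸ huK, v, hv, fun h => hvK ⟨v, h, rfl⟩, huv⟩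

lemma twoConnected_induce_iff : TwoConnected (G.induce S) ↔ TwoConnOn G S := by
  rw [TwoConnected, TwoConnOn, Nat.card_coe_set_eq, Subtype.forall]
  refine and_congr_right fun _ => forall₂_congr fun v hv => ?_
  rw [connOn_iff_connected_induce, connOn_induce_iff]
  have : Subtype.val '' {x : S | x ≠ ⟨v, hv⟩} = S \ {v} := by
    ext x
    constructor
    · rintro ⟨y, hy, rfl⟩
      exact ⟨y.2, fun e => hy (Subtype.ext e)⟩
    · exact fun hx => ⟨⟨x, hx.1⟩, fun e => hx.2 (congrArg Subtype.val e), rfl⟩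
  rw [this]

lemma noCutVertex_iff : NoCutVertex G S ↔ ∀ v ∈ S, (S \ {v}).Nonempty → ConnOn G (S \ {v}) := by
  simp only [NoCutVertex, connOn_iff_connected_induce]

/-- Every block of a graph of directed spaghetti treewidth two is a mamba. -/
lemma DirSpaghettiOn.isMamba_induce [Finite V] (D : DirSpaghettiOn G Set.univ)
    (hS : IsBlock G S) : IsMamba (G.induce S) := by
  obtain ⟨hne, hconn, hcut, -⟩ := hS
  rw [connOn_iff_connected_induce] at hconn
  have hpos := (Set.ncard_pos).2 hne
  rcases lt_or_ge S.ncard 3 with h3 | h3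
  · obtain h | h : S.ncard = 1 ∨ S.ncard = 2 := by omega
    · exact .inr (.inr (by rw [Nat.card_coe_set_eq, h]))
    · refine .inr (.inl ⟨by rw [Nat.card_coe_set_eq, h], ?_⟩)
      rintro ⟨a, ha⟩ ⟨b, hb⟩ hab
      have hab' : a ≠ b := fun e => hab (Subtype.ext e)
      have hS : ({a, b} : Set V) = S := Set.eq_of_subset_of_ncard_le
        (by rintro x (rfl | rfl) <;> assumption) (by rw [h, Set.ncard_pair hab'])
      obtain ⟨u, -, rfl, v, hv, hva, huv⟩ := hconn.2 {a} ⟨a, ha, rfl⟩ ⟨b, hb, hab'.symm⟩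
      rw [← hS] at hv
      exact hv.resolve_left hva ▸ huv
  · have h2 : TwoConnOn G S := by
      refine ⟨h3, fun v hv => noCutVertex_iff.1 hcut v hv ?_⟩
      rw [← Set.ncard_pos, Set.ncard_sdiff_singleton_of_mem hv]
      omega
    obtain ⟨D'⟩ := D.nonempty_mono (Set.subset_univ S)
    refine .inl ⟨twoConnected_induce_iff.2 h2, le_antisymm (pw_induce_le_iff.2 (D'.pathRep h2)) ?_⟩
    by_contra! hlt
    exact h2.not_pathRep_two (pw_induce_le_iff.1 (Nat.le_of_lt_succ hlt))

/-- Every 2-connected subgraph lies in a block. -/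
lemma TwoConnOn.exists_isBlock [Finite V] (h2 : TwoConnOn G S) : ∃ S', S ⊆ S' ∧ IsBlock G S' := by
  obtain ⟨S', hSS', hmax⟩ := Set.Finite.exists_le_maximal
    (Set.toFinite {S : Set V | (G.induce S).Connected ∧ NoCutVertex G S}) (a := S)
    ⟨(connOn_iff_connected_induce S).2 h2.connOn, noCutVertex_iff.2 fun v hv _ => h2.2 v hv⟩
  refine ⟨S', hSS', h2.connOn.1.mono hSS', hmax.1.1, hmax.1.2, fun S'' h h3 h4 => ?_⟩
  exact Set.Subset.antisymm (hmax.2 ⟨h3, h4⟩ h) h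

lemma pathRep_of_isMamba [Finite V] (hcard : 3 ≤ S.ncard) (h : IsMamba (G.induce S)) :
    PathRep G S ∅ 3 := by
  rcases h with ⟨-, h⟩ | ⟨h, -⟩ | h
  · exact pw_induce_le_iff.1 h.le
  · rw [Nat.card_coe_set_eq] at h
    omega
  · rw [Nat.card_coe_set_eq] at h
    omega

/-- A 2-connected graph without interval representation of width two is not a minor of a graph
whose blocks are mambas. -/
lemma not_isMinorOf_of_isMamba [Finite V] {W : Type} {H : SimpleGraph W}
    (hblock : ∀ S : Set V, IsBlock G S → IsMamba (G.induce S)) (hH : TwoConnOn H Set.univ)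
    (hint : ∀ l r : W → ℤ, (∀ w, l w ≤ r w) → (∀ w w', H.Adj w w' → l w ≤ r w') →
      (∀ (t : ℤ) (F : Finset W), 4 ≤ F.card → ∃ w ∈ F, t < l w ∨ r w < t) → False) :
    ¬ IsMinorOf H G := by
  rw [isMinorOf_iff_minorOn]
  intro h
  obtain ⟨S, h2, hS⟩ := h.exists_twoConnOn hH _ _ rfl
  obtain ⟨S', hSS', hS'⟩ := h2.exists_isBlock
  have hrep := pathRep_of_isMamba (h2.1.trans (Set.ncard_le_ncard hSS')) (hblock S' hS')
  obtain ⟨l, r, h3, h4, h5⟩ := (hS.mono hSS').exists_intervals hrep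
  exact hint l r h3 h4 h5

end Width

/-- For every finite simple graph `G`, TFAE: (1) `G` has directed spaghetti
treewidth at most two; (2) every block of `G` is a mamba; (3) `G` has no minor
isomorphic to `K₄`, `D₃` or `S₃`. -/
theorem statement16 {V : Type} [Fintype V] (G : SimpleGraph V) :
    List.TFAE
      [dptw G ≤ 2,
       ∀ S : Set V, IsBlock G S → IsMamba (G.induce S),
       ¬ IsMinorOf K4 G ∧ ¬ IsMinorOf D3 G ∧ ¬ IsMinorOf S3 G] := by
  tfae_have 1 → 2 := by
    rw [dptw_le_two_iff]
    exact fun ⟨D⟩ S hS => D.isMamba_induce hS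
  tfae_have 2 → 3 := fun h =>
    ⟨not_isMinorOf_of_isMamba h twoConnOn_K4 fun _ _ => K4_not_intervals,
      not_isMinorOf_of_isMamba h twoConnOn_D3 fun _ _ => D3_not_intervals,
      not_isMinorOf_of_isMamba h twoConnOn_S3 fun _ _ => S3_not_intervals⟩
  tfae_have 3 → 1 := by
    rw [dptw_le_two_iff, isMinorOf_iff_minorOn, isMinorOf_iff_minorOn, isMinorOf_iff_minorOn]
    exact fun h => nonempty_dirSpaghettiOn_of_not_minorOn _ _ rfl h.1 h.2.1 h.2.2
  tfae_finish
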